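/- arXiv:2003.14224 — 4 statements merged into one kernel-verified Lean document; each statement's English description precedes it below -/
import Mathlib

section
/- Let φ be an endomorphism of a nonzero finite-dimensional complex normed vector space whose spectral radius satisfies ρ(φ) > 0. Then the limit s(φ) = lim_{n→∞} (log‖φⁿ‖ − n·log ρ(φ))/log n exists, and s(φ) equals s, where s + 1 is the maximal size of the Jordan blocks of φ whose eigenvalue λ has |λ| = ρ(φ); equivalently, s(φ) = max over eigenvalues λ with |λ| = ρ(φ) of (m_λ − 1), where m_λ is the largest integer k ≥ 1 with ker(φ − λ·id)^k ≠ ker(φ − λ·id)^{k−1}. In particular s(φ) is a natural number. -/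
open Filter Topology Asymptotics

theorem isBigO_choose_mul_pow_sub (μ : ℂ) (j : ℕ) :
    (fun n : ℕ => (n.choose j : ℂ) * μ ^ (n - j)) =O[atTop]
      fun n : ℕ => (n : ℝ) ^ j * ‖μ‖ ^ n := by
  rcases eq_or_ne μ 0 with rfl | hμ
  · refine IsBigO.of_bound 1 ?_
    filter_upwards [eventually_gt_atTop j] with n hn
    rw [zero_pow (by omega), mul_zero, norm_zero]
    positivity
  · refine IsBigO.of_bound (‖μ‖ ^ j)⁻¹ ?_
    filter_upwards [eventually_ge_atTop j] with n hn
    have hpos : 0 < ‖μ‖ ^ j := pow_pos (norm_pos_iff.2 hμ) j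
    have hc : (n.choose j : ℝ) ≤ (n : ℝ) ^ j := by exact_mod_cast Nat.choose_le_pow n j
    rw [norm_mul, norm_pow, Complex.norm_natCast, pow_sub₀ _ (norm_ne_zero_iff.2 hμ) hn,
      Real.norm_of_nonneg (by positivity)]
    calc (n.choose j : ℝ) * (‖μ‖ ^ n * (‖μ‖ ^ j)⁻¹)
        ≤ (n : ℝ) ^ j * (‖μ‖ ^ n * (‖μ‖ ^ j)⁻¹) := by gcongr
      _ = _ := by ring

theorem isBigO_pow_mul_pow_choose_mul_pow_sub (μ : ℂ) (j : ℕ) :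
    (fun n : ℕ => (n : ℝ) ^ j * ‖μ‖ ^ n) =O[atTop]
      fun n : ℕ => (n.choose j : ℂ) * μ ^ (n - j) := by
  have hpow : (fun n : ℕ => ‖μ‖ ^ n) =O[atTop] fun n : ℕ => μ ^ (n - j) := by
    refine IsBigO.of_bound (‖μ‖ ^ j) ?_
    filter_upwards [eventually_ge_atTop j] with n hn
    rw [norm_pow, norm_pow, norm_norm, ← pow_add, Nat.add_sub_cancel' hn]
  have hchoose : (fun n : ℕ => (n : ℝ) ^ j) =O[atTop] fun n : ℕ => (n.choose j : ℂ) := by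
    refine (isTheta_choose j).2.trans (IsBigO.of_bound 1 (Eventually.of_forall fun n => ?_))
    simp
  exact hchoose.mul hpow

section Orbit

variable {V : Type*} [NormedAddCommGroup V] [NormedSpace ℂ V]

theorem pow_apply_eq_sum_of_pow_sub_smul_apply_eq_zero (φ : V →L[ℂ] V) {μ : ℂ} {m : ℕ} {v : V}
    (hv : (((φ.toLinearMap : Module.End ℂ V) - μ • 1) ^ m) v = 0) {n : ℕ} (hn : m ≤ n) :
    (φ ^ n) v = ∑ j ∈ Finset.range m, ((n.choose j : ℂ) * μ ^ (n - j)) •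
      (((φ.toLinearMap : Module.End ℂ V) - μ • 1) ^ j) v := by
  set N : Module.End ℂ V := (φ.toLinearMap : Module.End ℂ V) - μ • 1 with hN
  have hφ : (φ ^ n) v = ((N + algebraMap ℂ (Module.End ℂ V) μ) ^ n) v := by
    rw [hN, Algebra.algebraMap_eq_smul_one, sub_add_cancel, ← ContinuousLinearMap.coe_coe,
      ContinuousLinearMap.toLinearMap_pow]
  rw [hφ, Commute.add_pow (Algebra.commutes μ N).symm, LinearMap.sum_apply]
  have hterm : ∀ j, (N ^ j * algebraMap ℂ (Module.End ℂ V) μ ^ (n - j) * (n.choose j)) v =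
      ((n.choose j : ℂ) * μ ^ (n - j)) • (N ^ j) v := fun j => by
    rw [← map_pow, ← map_natCast (algebraMap ℂ (Module.End ℂ V)), mul_assoc, ← map_mul,
      ← Algebra.commutes, ← Algebra.smul_def, mul_comm, LinearMap.smul_apply]
  simp only [hterm]
  refine (Finset.sum_subset (Finset.range_mono (by omega)) fun j _ hj => ?_).symm
  rw [Module.End.pow_map_zero_of_le (not_lt.1 (mt Finset.mem_range.2 hj)) hv, smul_zero]

theorem isBigO_pow_apply_of_pow_sub_smul_apply_eq_zero (φ : V →L[ℂ] V) {μ : ℂ} {m s : ℕ} {r : ℝ}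
    {v : V} (hv : (((φ.toLinearMap : Module.End ℂ V) - μ • 1) ^ m) v = 0)
    (hμ : ‖μ‖ < r ∨ ‖μ‖ = r ∧ m ≤ s + 1) :
    (fun n : ℕ => (φ ^ n) v) =O[atTop] fun n : ℕ => (n : ℝ) ^ s * r ^ n := by
  have heq : (fun n : ℕ => (φ ^ n) v) =ᶠ[atTop]
      ∑ j ∈ Finset.range m, fun n : ℕ => ((n.choose j : ℂ) * μ ^ (n - j)) •
        (((φ.toLinearMap : Module.End ℂ V) - μ • 1) ^ j) v := by
    filter_upwards [eventually_ge_atTop m] with n hn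
    rw [pow_apply_eq_sum_of_pow_sub_smul_apply_eq_zero φ hv hn, Finset.sum_apply]
  refine heq.trans_isBigO (IsBigO.sum fun j hj => ?_)
  have hj' := Finset.mem_range.1 hj
  refine IsBigO.trans (g := fun n : ℕ => (n : ℝ) ^ j * ‖μ‖ ^ n) ?_ ?_
  · simpa using (isBigO_choose_mul_pow_sub μ j).smul
      (isBigO_const_const ((((φ.toLinearMap : Module.End ℂ V) - μ • 1) ^ j) v)
        (one_ne_zero (α := ℝ)) atTop)
  · rcases hμ with hlt | ⟨rfl, hms⟩
    · have h := isLittleO_pow_const_mul_const_pow_const_pow_of_norm_lt j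
        (r₁ := ‖μ‖) (r₂ := r) (by rwa [norm_norm])
      refine h.isBigO.trans (IsBigO.of_bound 1 ?_)
      filter_upwards [eventually_ge_atTop 1] with n hn
      have h1 : (1 : ℝ) ≤ (n : ℝ) ^ s := one_le_pow₀ (by exact_mod_cast hn)
      rw [one_mul, norm_mul, Real.norm_of_nonneg (zero_le_one.trans h1)]
      exact le_mul_of_one_le_left (norm_nonneg _) h1
    · refine IsBigO.of_bound 1 ?_
      filter_upwards [eventually_ge_atTop 1] with n hn
      have h1 : (1 : ℝ) ≤ n := by exact_mod_cast hn
      rw [one_mul, Real.norm_of_nonneg (by positivity), Real.norm_of_nonneg (by positivity)]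
      gcongr
      omega

theorem isBigO_pow_mul_pow_norm_pow (φ : V →L[ℂ] V) {μ : ℂ} {s : ℕ} {v : V}
    (hv : (((φ.toLinearMap : Module.End ℂ V) - μ • 1) ^ (s + 1)) v = 0)
    (hv' : (((φ.toLinearMap : Module.End ℂ V) - μ • 1) ^ s) v ≠ 0) :
    (fun n : ℕ => (n : ℝ) ^ s * ‖μ‖ ^ n) =O[atTop] fun n : ℕ => ‖φ ^ n‖ := by
  set N : Module.End ℂ V := (φ.toLinearMap : Module.End ℂ V) - μ • 1
  set lead : ℕ → V := fun n => ((n.choose s : ℂ) * μ ^ (n - s)) • (N ^ s) v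
  have hG : (fun n : ℕ => (n : ℝ) ^ s * ‖μ‖ ^ n) =O[atTop] lead := by
    simpa using (isBigO_pow_mul_pow_choose_mul_pow_sub μ s).smul
      (isBigO_const_const (1 : ℝ) hv' atTop)
  have hlow : (∑ j ∈ Finset.range s, fun n : ℕ => ((n.choose j : ℂ) * μ ^ (n - j)) • (N ^ j) v)
      =o[atTop] lead := by
    refine IsLittleO.trans_isBigO (IsLittleO.sum fun j hj => ?_) hG
    have h1 : (fun n : ℕ => ((n.choose j : ℂ) * μ ^ (n - j)) • (N ^ j) v) =O[atTop]
        fun n : ℕ => (n : ℝ) ^ j * ‖μ‖ ^ n := by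
      simpa using (isBigO_choose_mul_pow_sub μ j).smul
        (isBigO_const_const ((N ^ j) v) (one_ne_zero (α := ℝ)) atTop)
    have h2 : (fun n : ℕ => (n : ℝ) ^ j) =o[atTop] fun n : ℕ => (n : ℝ) ^ s :=
      (isLittleO_pow_pow_atTop_of_lt (𝕜 := ℝ) (Finset.mem_range.1 hj)).comp_tendsto
        tendsto_natCast_atTop_atTop
    exact h1.trans_isLittleO (h2.mul_isBigO (isBigO_refl _ _))
  have heq : (fun n => (∑ j ∈ Finset.range s, fun n : ℕ =>
      ((n.choose j : ℂ) * μ ^ (n - j)) • (N ^ j) v) n + lead n) =ᶠ[atTop]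
      fun n : ℕ => (φ ^ n) v := by
    filter_upwards [eventually_ge_atTop (s + 1)] with n hn
    rw [pow_apply_eq_sum_of_pow_sub_smul_apply_eq_zero φ hv hn, Finset.sum_apply,
      Finset.sum_range_succ]
  refine ((hG.trans hlow.right_isBigO_add).trans_eventuallyEq heq).trans
    (IsBigO.of_bound ‖v‖ (Eventually.of_forall fun n => ?_))
  rw [norm_norm, mul_comm]
  exact (φ ^ n).le_opNorm v

theorem isBigO_norm_of_forall_isBigO_apply [CompleteSpace V] {A : ℕ → V →L[ℂ] V} {G : ℕ → ℝ}
    (hG : ∀ᶠ n in atTop, G n ≠ 0) (h : ∀ v, (fun n => A n v) =O[atTop] G) :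
    (fun n => ‖A n‖) =O[atTop] G := by
  obtain ⟨C, hC⟩ := banach_steinhaus (g := fun n => ((G n)⁻¹ : ℂ) • A n) fun v => by
    refine (isBigO_one_nat_atTop_iff).1 ?_
    obtain ⟨c, hc⟩ := (h v).bound
    refine IsBigO.of_bound c ?_
    filter_upwards [hc, hG] with n hn hn0
    have hpos := norm_pos_iff.2 hn0
    rw [smul_apply, norm_smul, norm_inv, Complex.norm_real, norm_one, mul_one,
      inv_mul_le_iff₀ hpos, mul_comm]
    exact hn
  refine IsBigO.of_bound C ?_
  filter_upwards [hG] with n hn0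
  have := hC n
  rwa [norm_smul, norm_inv, Complex.norm_real, inv_mul_le_iff₀ (norm_pos_iff.2 hn0), mul_comm,
    ← norm_norm (A n)] at this

end Orbit

theorem tendsto_log_sub_div_log_of_isTheta {u : ℕ → ℝ} {s : ℕ} {r : ℝ} (hr : 0 < r)
    (h : u =Θ[atTop] fun n : ℕ => (n : ℝ) ^ s * r ^ n) :
    Tendsto (fun n : ℕ => (Real.log (u n) - n * Real.log r) / Real.log n) atTop (𝓝 (s : ℝ)) := by
  obtain ⟨C, hC0, hC⟩ := h.1.exists_pos
  obtain ⟨c, hc0, hc⟩ := h.2.exists_pos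
  have hbdd : (fun n : ℕ => Real.log (u n) - n * Real.log r - s * Real.log n) =O[atTop]
      fun _ => (1 : ℝ) := by
    refine IsBigO.of_bound (|Real.log C| + |Real.log c|) ?_
    filter_upwards [hC.bound, hc.bound, eventually_ge_atTop 1] with n h1 h2 hn
    have hn0 : (0 : ℝ) < n := by exact_mod_cast hn
    have hG : 0 < (n : ℝ) ^ s * r ^ n := by positivity
    have hlogG : Real.log ((n : ℝ) ^ s * r ^ n) = s * Real.log n + n * Real.log r := by
      rw [Real.log_mul (by positivity) (by positivity), Real.log_pow, Real.log_pow]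
    rw [Real.norm_of_nonneg hG.le] at h1 h2
    have hu : 0 < ‖u n‖ := pos_of_mul_pos_right (hG.trans_le h2) hc0.le
    have l1 := Real.log_le_log hu h1
    have l2 := Real.log_le_log hG h2
    rw [Real.log_mul hC0.ne' hG.ne', hlogG, Real.norm_eq_abs, Real.log_abs] at l1
    rw [Real.log_mul hc0.ne' hu.ne', hlogG, Real.norm_eq_abs, Real.log_abs] at l2
    rw [norm_one, mul_one, Real.norm_eq_abs, abs_le]
    have := le_abs_self (Real.log C)
    have := le_abs_self (Real.log c)
    have := abs_nonneg (Real.log C)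
    have := abs_nonneg (Real.log c)
    constructor <;> linarith
  have hlog : Tendsto (fun n : ℕ => Real.log n) atTop atTop :=
    Real.tendsto_log_atTop.comp tendsto_natCast_atTop_atTop
  have hzero := (hbdd.trans_isLittleO
    (isLittleO_const_left.2 (Or.inr (tendsto_norm_atTop_atTop.comp hlog)))).tendsto_div_nhds_zero
  have := hzero.add_const (s : ℝ)
  rw [zero_add] at this
  refine this.congr' ?_
  filter_upwards [hlog.eventually_gt_atTop 0] with n hn
  field_simp
  ring

section KernelChain

variable {K V : Type*} [Field K] [AddCommGroup V] [Module K V] [FiniteDimensional K V]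

theorem finrank_mem_upperBounds_setOf_ker_pow_ne (N : Module.End K V) :
    Module.finrank K V ∈ upperBounds
      {k : ℕ | LinearMap.ker (N ^ k) ≠ LinearMap.ker (N ^ (k - 1))} := by
  intro k hk
  by_contra! hlt
  exact hk ((Module.End.ker_pow_eq_ker_pow_finrank_of_le hlt.le).trans
    (Module.End.ker_pow_eq_ker_pow_finrank_of_le (by omega)).symm)

theorem pow_sSup_apply_eq_zero (N : Module.End K V) {v : V} {n : ℕ} (hv : (N ^ n) v = 0) :
    (N ^ sSup {k : ℕ | LinearMap.ker (N ^ k) ≠ LinearMap.ker (N ^ (k - 1))}) v = 0 := by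
  set D := sSup {k : ℕ | LinearMap.ker (N ^ k) ≠ LinearMap.ker (N ^ (k - 1))}
  have hstep : ∀ i, (N ^ (D + i)) v = 0 → (N ^ D) v = 0 := by
    intro i
    induction i with
    | zero => exact id
    | succ i ih =>
      intro h
      have hmem : D + (i + 1) ∉ {k : ℕ | LinearMap.ker (N ^ k) ≠ LinearMap.ker (N ^ (k - 1))} :=
        fun hmem => by
          have := le_csSup ⟨_, finrank_mem_upperBounds_setOf_ker_pow_ne N⟩ hmem
          omega
      have hker : LinearMap.ker (N ^ (D + (i + 1))) = LinearMap.ker (N ^ (D + i)) :=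
        not_not.1 hmem
      exact ih (LinearMap.mem_ker.1 (hker ▸ LinearMap.mem_ker.2 h))
  exact hstep n (Module.End.pow_map_zero_of_le (by omega) hv)

theorem sSup_mem_setOf_ker_pow_ne {N : Module.End K V} (hN : LinearMap.ker N ≠ ⊥) :
    sSup {k : ℕ | LinearMap.ker (N ^ k) ≠ LinearMap.ker (N ^ (k - 1))} ∈
      {k : ℕ | LinearMap.ker (N ^ k) ≠ LinearMap.ker (N ^ (k - 1))} := by
  refine Nat.sSup_mem ⟨1, ?_⟩ ⟨_, finrank_mem_upperBounds_setOf_ker_pow_ne N⟩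
  rw [Set.mem_ofPred_eq, pow_one, Nat.sub_self, pow_zero, Module.End.one_eq_id, LinearMap.ker_id]
  exact hN

theorem exists_pow_apply_ne_zero_of_sSup_eq {N : Module.End K V} (hN : LinearMap.ker N ≠ ⊥) {m : ℕ}
    (hm : m + 1 = sSup {k : ℕ | LinearMap.ker (N ^ k) ≠ LinearMap.ker (N ^ (k - 1))}) :
    ∃ v, (N ^ (m + 1)) v = 0 ∧ (N ^ m) v ≠ 0 := by
  have hmem := sSup_mem_setOf_ker_pow_ne hN
  rw [← hm, Set.mem_ofPred_eq, Nat.add_sub_cancel] at hmem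
  by_contra! h
  exact hmem (le_antisymm h fun v hv => Module.End.pow_map_zero_of_le (Nat.le_succ m) hv)

end KernelChain

/-- Let `φ` be an endomorphism of a nonzero finite-dimensional complex
normed vector space whose spectral radius `r = ρ(φ)` (the maximal modulus of an eigenvalue)
is positive. Then the limit `s(φ) = lim (log ‖φⁿ‖ - n log ρ(φ)) / log n` exists and is a
natural number `s`, where `s` is the maximum, over the eigenvalues `λ` with `|λ| = ρ(φ)`,
of `m_λ - 1`, `m_λ` being the largest `k ≥ 1` with
`ker (φ - λ·id)^k ≠ ker (φ - λ·id)^(k-1)` (i.e. `s + 1` is the maximal size of the Jordan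
blocks of `φ` whose eigenvalue has maximal modulus). -/
theorem polynomial_growth_rate_of_linear_map
    {V : Type*} [NormedAddCommGroup V] [NormedSpace ℂ V]
    [FiniteDimensional ℂ V] [Nontrivial V] (φ : V →L[ℂ] V) (r : ℝ)
    (hr : IsGreatest {x : ℝ | ∃ lam : ℂ,
      Module.End.HasEigenvalue (φ.toLinearMap : Module.End ℂ V) lam ∧ x = ‖lam‖} r)
    (hrpos : 0 < r) :
    ∃ s : ℕ,
      Tendsto (fun n : ℕ => (Real.log ‖φ ^ n‖ - n * Real.log r) / Real.log n)
        atTop (𝓝 (s : ℝ)) ∧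
      s = sSup {m : ℕ | ∃ lam : ℂ,
        Module.End.HasEigenvalue (φ.toLinearMap : Module.End ℂ V) lam ∧ ‖lam‖ = r ∧
        m + 1 = sSup {k : ℕ |
          LinearMap.ker (((φ.toLinearMap : Module.End ℂ V) - lam • 1) ^ k) ≠
          LinearMap.ker (((φ.toLinearMap : Module.End ℂ V) - lam • 1) ^ (k - 1))}} := by
  have hker : ∀ {lam : ℂ}, Module.End.HasEigenvalue (φ.toLinearMap : Module.End ℂ V) lam →
      LinearMap.ker ((φ.toLinearMap : Module.End ℂ V) - lam • 1) ≠ ⊥ := fun h => by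
    rwa [Module.End.hasEigenvalue_iff, Module.End.eigenspace_def] at h
  set S := {m : ℕ | ∃ lam : ℂ,
    Module.End.HasEigenvalue (φ.toLinearMap : Module.End ℂ V) lam ∧ ‖lam‖ = r ∧
    m + 1 = sSup {k : ℕ |
      LinearMap.ker (((φ.toLinearMap : Module.End ℂ V) - lam • 1) ^ k) ≠
      LinearMap.ker (((φ.toLinearMap : Module.End ℂ V) - lam • 1) ^ (k - 1))}}
  have hmem : ∀ {lam : ℂ}, Module.End.HasEigenvalue (φ.toLinearMap : Module.End ℂ V) lam →
      ‖lam‖ = r → sSup {k : ℕ |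
        LinearMap.ker (((φ.toLinearMap : Module.End ℂ V) - lam • 1) ^ k) ≠
        LinearMap.ker (((φ.toLinearMap : Module.End ℂ V) - lam • 1) ^ (k - 1))} - 1 ∈ S := by
    intro lam hlam hnorm
    refine ⟨lam, hlam, hnorm, Nat.sub_add_cancel (Nat.one_le_iff_ne_zero.2 fun h0 => ?_)⟩
    have h := sSup_mem_setOf_ker_pow_ne (hker hlam)
    rw [h0] at h
    exact h rfl
  have hbdd : BddAbove S := by
    refine ⟨Module.finrank ℂ V, ?_⟩
    rintro m ⟨lam, hlam, -, hm⟩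
    have h := finrank_mem_upperBounds_setOf_ker_pow_ne _ (sSup_mem_setOf_ker_pow_ne (hker hlam))
    rw [← hm] at h
    omega
  have hne : S.Nonempty := by
    obtain ⟨lam, hlam, hnorm⟩ := hr.1
    exact ⟨_, hmem hlam hnorm.symm⟩
  obtain ⟨lam, hlam, hnorm, hs⟩ := Nat.sSup_mem hne hbdd
  refine ⟨sSup S, tendsto_log_sub_div_log_of_isTheta hrpos ⟨?_, ?_⟩, rfl⟩
  · have : CompleteSpace V := FiniteDimensional.complete ℂ V
    refine isBigO_norm_of_forall_isBigO_apply ?_ fun v => ?_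
    · filter_upwards [eventually_ge_atTop 1] with n hn
      have : (0 : ℝ) < n := by exact_mod_cast hn
      positivity
    have hv : v ∈ ⨆ μ, Module.End.maxGenEigenspace φ.toLinearMap μ := by
      rw [Module.End.iSup_maxGenEigenspace_eq_top]
      exact Submodule.mem_top
    refine Submodule.iSup_induction _
      (motive := fun x => (fun n : ℕ => (φ ^ n) x) =O[atTop] fun n : ℕ => (n : ℝ) ^ sSup S * r ^ n)
      hv (fun μ x hx => ?_) (by simpa using isBigO_zero _ _)
      fun x y hx hy => by simpa using hx.add hy
    · obtain ⟨k, hk⟩ := (Module.End.mem_maxGenEigenspace _ _ _).1 hx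
      by_cases hμ : Module.End.HasEigenvalue (φ.toLinearMap : Module.End ℂ V) μ
      · refine isBigO_pow_apply_of_pow_sub_smul_apply_eq_zero φ (pow_sSup_apply_eq_zero _ hk) ?_
        rcases (hr.2 ⟨μ, hμ, rfl⟩).lt_or_eq with hlt | heq
        · exact Or.inl hlt
        · refine Or.inr ⟨heq, ?_⟩
          have := le_csSup hbdd (hmem hμ heq)
          omega
      · rw [Module.End.hasEigenvalue_iff, Module.End.eigenspace_def, not_not,
          LinearMap.ker_eq_bot] at hμ
        have hx0 : x = 0 := by
          have hinj := hμ.iterate k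
          rw [← Module.End.coe_pow] at hinj
          exact hinj (hk.trans (map_zero _).symm)
        simpa [hx0] using isBigO_zero _ _
  · obtain ⟨v, hv, hv'⟩ := exists_pow_apply_ne_zero_of_sSup_eq (hker hlam) hs
    have h := isBigO_pow_mul_pow_norm_pow φ hv hv'
    rwa [hnorm] at h
end

section
/- Let D be a triangulated category, F an endofunctor of D (triangulated and not virtually zero), and let G and G′ be any two split generators of D. Then for every t ∈ ℝ with h_t(F) ≠ −∞, one has h^pol_t(F) = limsup_{n→∞} (log δ_t(G, Fⁿ(G′)) − n·h_t(F))/log n. In particular, the categorical polynomial entropy h^pol_t(F) is independent of the choice of the split generator used to define it. -/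
open CategoryTheory Category Limits Pretriangulated Filter Topology
open scoped ENNReal

universe v u

namespace CatDyn

variable {D : Type u} [Category.{v} D] [Limits.HasZeroObject D] [Preadditive D]
  [HasShift D ℤ] [∀ n : ℤ, (CategoryTheory.shiftFunctor D n).Additive] [Pretriangulated D]
  [HasBinaryBiproducts D]

/-- A tower `0 = A₀ → A₁ → ⋯ → A_m ≅ N ⊕ N'` with cones shifts of `M`,
computing the complexity of `N` with respect to `M`. -/
structure Tower (M N : D) where
  m : ℕ
  A : Fin (m + 1) → D
  f : ∀ i : Fin m, A i.castSucc ⟶ A i.succ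
  shifts : Fin m → ℤ
  N' : D
  isZero_zero : IsZero (A 0)
  lastIso : A (Fin.last m) ≅ N ⊞ N'
  dist : ∀ i : Fin m, ∃ (g : A i.succ ⟶ M⟦shifts i⟧) (h : M⟦shifts i⟧ ⟶ (A i.castSucc)⟦(1 : ℤ)⟧),
    Triangle.mk (f i) g h ∈ distTriang D

/-- The value `Σ_k e^{n_k t}` of a tower. -/
noncomputable def Tower.value {M N : D} (t : ℝ) (T : Tower M N) : ℝ≥0∞ :=
  ∑ i : Fin T.m, ENNReal.ofReal (Real.exp (T.shifts i * t))

/-- The complexity function `δ_t(M,N)`, valued in `[0,∞]`; it is `∞` iff no tower exists,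
i.e. iff `N` is not in the thick triangulated subcategory generated by `M`. -/
noncomputable def complexity (t : ℝ) (M N : D) : ℝ≥0∞ :=
  ⨅ T : Tower M N, T.value t

/-- `G` is a split generator: every object admits a tower over `G`, i.e. the thick
triangulated subcategory generated by `G` is all of `D`. -/
def IsSplitGenerator (G : D) : Prop := ∀ N : D, Nonempty (Tower G N)

/-- The `n`-th iterate of an endofunctor. -/
def fpow (F : D ⥤ D) : ℕ → D ⥤ D
  | 0 => 𝟭 D
  | n + 1 => fpow F n ⋙ F

/-- `F` is not virtually zero: no positive iterate is the zero functor. -/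
def NotVirtuallyZero (F : D ⥤ D) : Prop := ∀ n : ℕ, 0 < n → ¬ IsZero (fpow F n)

/-- The categorical entropy `h_t(F) ∈ [-∞,∞)`, computed with split generator `G`
(the limit exists and is independent of the generator). -/
noncomputable def entropy (t : ℝ) (F : D ⥤ D) (G : D) : EReal :=
  limsup (fun n : ℕ =>
    ENNReal.log (complexity t G ((fpow F n).obj G)) * (((n : ℝ)⁻¹ : ℝ) : EReal)) atTop

/-- The categorical polynomial entropy
`h^pol_t(F) = limsup (log δ_t(G, Fⁿ G) - n h_t(F)) / log n`. -/
noncomputable def polyEntropy (t : ℝ) (F : D ⥤ D) (G : D) : EReal :=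
  limsup (fun n : ℕ =>
    (ENNReal.log (complexity t G ((fpow F n).obj G)) - ((n : ℝ) : EReal) * entropy t F G)
      * ((((Real.log n)⁻¹ : ℝ)) : EReal)) atTop

/-- The lower categorical polynomial entropy (with `liminf` instead of `limsup`). -/
noncomputable def polyEntropyLow (t : ℝ) (F : D ⥤ D) (G : D) : EReal :=
  liminf (fun n : ℕ =>
    (ENNReal.log (complexity t G ((fpow F n).obj G)) - ((n : ℝ) : EReal) * entropy t F G)
      * ((((Real.log n)⁻¹ : ℝ)) : EReal)) atTop

section Linear

variable (𝕜 : Type*) [Field 𝕜] [Linear 𝕜 D]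

/-- The Ext-distance `ε_t(M,N) = Σ_{k∈ℤ} dim Hom(M, N[k]) e^{-kt}`. -/
noncomputable def extDist (t : ℝ) (M N : D) : ℝ≥0∞ :=
  ∑' k : ℤ, (Module.finrank 𝕜 (M ⟶ N⟦k⟧) : ℝ≥0∞) * ENNReal.ofReal (Real.exp (-k * t))

variable (D) in
/-- `D` is Hom-finite over `𝕜`. -/
def HomFinite : Prop := ∀ X Y : D, FiniteDimensional 𝕜 (X ⟶ Y)

variable (D) in
/-- `D` is Ext-bounded: `Hom(X, Y[k]) = 0` for all but finitely many `k`. -/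
def ExtBounded : Prop := ∀ X Y : D, {k : ℤ | ∃ f : X ⟶ Y⟦k⟧, f ≠ 0}.Finite

variable (D) in
/-- The comparability property: `δ_t` and `ε_t` control each other, uniformly in the objects. -/
def Comparability : Prop :=
  ∃ C₁ C₂ : ℝ → ℝ, (∀ t, 0 < C₁ t ∧ 0 < C₂ t) ∧
    ∀ (t : ℝ) (M N : D),
      ENNReal.ofReal (C₁ t) * extDist 𝕜 t M N ≤ complexity t M N ∧
      complexity t M N ≤ ENNReal.ofReal (C₂ t) * extDist 𝕜 t M N

end Linear

section Cells

omit [HasBinaryBiproducts D]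

/-- `CellMap t M X z r`: the morphism `z : X ⟶ Y` is a finite composition of morphisms whose cones
are shifts `M⟦n⟧`, and `r` is the sum of the corresponding weights `e^{nt}`. -/
inductive CellMap (t : ℝ) (M X : D) : ∀ {Y : D}, (X ⟶ Y) → ℝ≥0∞ → Prop
  | id : CellMap t M X (𝟙 X) 0
  | attach {Y Z B : D} {z : X ⟶ Y} {r : ℝ≥0∞} (hz : CellMap t M X z r) {f : Y ⟶ Z} {g : Z ⟶ B}
      {h : B ⟶ Y⟦(1 : ℤ)⟧} (hT : Triangle.mk f g h ∈ distTriang D) (n : ℤ) (e : B ≅ M⟦n⟧) :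
      CellMap t M X (z ≫ f) (r + ENNReal.ofReal (Real.exp (n * t)))

/-- `Built t M N r`: the object `N` can be built from `M` by attaching shifts `M⟦n⟧`, of total
weight `r = ∑ e^{nt}`, and by passing to retracts. -/
inductive Built (t : ℝ) (M : D) : D → ℝ≥0∞ → Prop
  | zero {X : D} (hX : IsZero X) : Built t M X 0
  | attach {Y Z B : D} {r : ℝ≥0∞} (hY : Built t M Y r) {f : Y ⟶ Z} {g : Z ⟶ B}
      {h : B ⟶ Y⟦(1 : ℤ)⟧} (hT : Triangle.mk f g h ∈ distTriang D) (n : ℤ) (e : B ≅ M⟦n⟧) :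
      Built t M Z (r + ENNReal.ofReal (Real.exp (n * t)))
  | retract {Y Z : D} {r : ℝ≥0∞} (hY : Built t M Y r) (ρ : Retract Z Y) : Built t M Z r

variable {t : ℝ} {M : D}

lemma ofReal_exp_add_mul (n s : ℤ) (t : ℝ) :
    ENNReal.ofReal (Real.exp ((n + s : ℤ) * t)) =
      ENNReal.ofReal (Real.exp (n * t)) * ENNReal.ofReal (Real.exp (s * t)) := by
  rw [← ENNReal.ofReal_mul (Real.exp_pos _).le, ← Real.exp_add]
  push_cast
  ring_nf

lemma exists_middle_of_distTriang {X Y Z X' Y' Z' : D} {f : X ⟶ Y} {g : Y ⟶ Z}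
    {h : Z ⟶ X⟦(1 : ℤ)⟧} (hT : Triangle.mk f g h ∈ distTriang D) {f' : X' ⟶ Y'} {g' : Y' ⟶ Z'}
    {h' : Z' ⟶ X'⟦(1 : ℤ)⟧} (hT' : Triangle.mk f' g' h' ∈ distTriang D)
    (a : X ⟶ X') (c : Z ⟶ Z') (comm : h ≫ a⟦(1 : ℤ)⟧' = c ≫ h') :
    ∃ b : Y ⟶ Y', f ≫ b = a ≫ f' ∧ g ≫ c = b ≫ g' :=
  complete_distinguished_triangle_morphism₂ _ _ hT hT' a c comm

lemma exists_extension_of_distTriang {X Y Z : D} {f : X ⟶ Y} {g : Y ⟶ Z}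
    {h : Z ⟶ X⟦(1 : ℤ)⟧} (hT : Triangle.mk f g h ∈ distTriang D) {T : D} (a : X ⟶ T)
    (ha : h ≫ a⟦(1 : ℤ)⟧' = 0) : ∃ b : Y ⟶ T, f ≫ b = a := by
  obtain ⟨b, hb, -⟩ := complete_distinguished_triangle_morphism₂ _ _ hT
    (contractible_distinguished T) a 0 (ha.trans zero_comp.symm)
  exact ⟨b, hb.trans (comp_id a)⟩

/-- In a morphism of distinguished triangles, if the outer components are split monomorphisms
with compatible retractions, then the middle object is a retract. -/
lemma nonempty_retract_middle {X Y Z X' Y' Z' : D} {f : X ⟶ Y} {g : Y ⟶ Z}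
    {h : Z ⟶ X⟦(1 : ℤ)⟧} (hT : Triangle.mk f g h ∈ distTriang D) {f' : X' ⟶ Y'} {g' : Y' ⟶ Z'}
    {h' : Z' ⟶ X'⟦(1 : ℤ)⟧} (hT' : Triangle.mk f' g' h' ∈ distTriang D)
    (ρ : Retract X X') (σ : Retract Z Z')
    (hi : h ≫ ρ.i⟦(1 : ℤ)⟧' = σ.i ≫ h') (hr : h' ≫ ρ.r⟦(1 : ℤ)⟧' = σ.r ≫ h) :
    Nonempty (Retract Y Y') := by
  obtain ⟨a, ha₁, ha₂⟩ := exists_middle_of_distTriang hT hT' ρ.i σ.i hi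
  obtain ⟨b, hb₁, hb₂⟩ := exists_middle_of_distTriang hT' hT ρ.r σ.r hr
  have h₁ : f ≫ a ≫ b = f := by rw [reassoc_of% ha₁, hb₁, ρ.retract_assoc]
  have h₂ : (a ≫ b) ≫ g = g := by
    rw [Category.assoc, ← hb₂, ← reassoc_of% ha₂, σ.retract, comp_id]
  let φ : Triangle.mk f g h ⟶ Triangle.mk f g h :=
    { hom₁ := 𝟙 _
      hom₂ := a ≫ b
      hom₃ := 𝟙 _
      comm₁ := h₁.trans (id_comp f).symm
      comm₂ := (comp_id g).trans h₂.symm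
      comm₃ := by rw [CategoryTheory.Functor.map_id, comp_id, id_comp] }
  have : IsIso (a ≫ b) := isIso₂_of_isIso₁₃ φ hT hT (by dsimp [φ]; infer_instance)
    (by dsimp [φ]; infer_instance)
  exact ⟨⟨a, b ≫ inv (a ≫ b), by rw [← Category.assoc, IsIso.hom_inv_id]⟩⟩

/-- Pulling back the cells of `A` along a morphism `y : Y ⟶ A`. -/
lemma CellMap.exists_pullback {X A : D} (hX : IsZero X) {z : X ⟶ A} {r : ℝ≥0∞}
    (hz : CellMap t M X z r) :
    ∀ {Y : D} (y : Y ⟶ A), ∃ (Z₀ : D) (w : Z₀ ⟶ Y), CellMap t M Z₀ w r ∧ w ≫ y = 0 := by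
  induction hz with
  | id => exact fun {Y} y => ⟨Y, 𝟙 Y, .id, by simpa using hX.eq_zero_of_tgt y⟩
  | @attach A A₂ B z r hz f g h hT n e ih =>
    intro Y y
    obtain ⟨Y', f', h', hT'⟩ := distinguished_cocone_triangle₁ (y ≫ g)
    obtain ⟨y', hy', -⟩ : ∃ y' : Y' ⟶ A, f' ≫ y = y' ≫ f ∧ h' ≫ y'⟦(1 : ℤ)⟧' = 𝟙 B ≫ h :=
      complete_distinguished_triangle_morphism₁ _ _ hT' hT y (𝟙 B) (comp_id _)
    obtain ⟨Z₀, w, hw, hw₀⟩ := ih y'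
    exact ⟨Z₀, w ≫ f', hw.attach hT' n e, by simp [hy', reassoc_of% hw₀]⟩

/-- Pushing out the cells of `z : X ⟶ Y` along a morphism `l : X ⟶ X'`. The resulting square is
a weak pushout, so `W` weakly represents extensions of morphisms out of `X'`. -/
lemma CellMap.exists_pushout {X Y : D} {z : X ⟶ Y} {r : ℝ≥0∞} (hz : CellMap t M X z r)
    {X' : D} (l : X ⟶ X') :
    ∃ (W : D) (u : X' ⟶ W) (a : Y ⟶ W), CellMap t M X' u r ∧
      ∀ {T : D} (f : X' ⟶ T) (k : Y ⟶ T), l ≫ f = z ≫ k → ∃ ψ : W ⟶ T, a ≫ ψ = k := by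
  induction hz with
  | id => exact ⟨X', 𝟙 X', l, .id, fun f k hfk => ⟨f, by simpa using hfk⟩⟩
  | @attach Y Y₂ B z r hz f g h hT n e ih =>
    obtain ⟨W, u, a, hu, hW⟩ := ih
    obtain ⟨W₂, f', g', hT'⟩ := distinguished_cocone_triangle₂ (h ≫ a⟦(1 : ℤ)⟧')
    obtain ⟨a₂, ha₁, ha₂⟩ :=
      exists_middle_of_distTriang hT hT' a (𝟙 B) (id_comp (h ≫ a⟦(1 : ℤ)⟧')).symm
    refine ⟨W₂, u ≫ f', a₂, hu.attach hT' n e, fun {T} p k hpk => ?_⟩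
    obtain ⟨ψ, hψ⟩ := hW p (f ≫ k) (by simpa using hpk)
    have hh : h ≫ f⟦(1 : ℤ)⟧' = 0 := comp_distTriang_mor_zero₃₁ _ hT
    obtain ⟨χ, hχ⟩ := exists_extension_of_distTriang hT' ψ (by
      rw [Category.assoc, ← Functor.map_comp, hψ, Functor.map_comp, reassoc_of% hh, zero_comp])
    have hk : f ≫ (k - a₂ ≫ χ) = 0 := by
      rw [Preadditive.comp_sub, reassoc_of% ha₁, hχ, hψ, sub_self]
    obtain ⟨m, hm⟩ : ∃ m : B ⟶ T, k - a₂ ≫ χ = g ≫ m := Triangle.yoneda_exact₂ _ hT _ hk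
    refine ⟨χ + g' ≫ m, ?_⟩
    rw [Preadditive.comp_add, ← reassoc_of% ha₂, ← hm]
    abel

/-- If `X ⟶ Y ⟶ A` is part of a distinguished triangle, then `Y` is a retract of an object
obtained from `X` by attaching the cells of `A`. -/
lemma CellMap.exists_retract_of_distTriang {X₀ A : D} (hX₀ : IsZero X₀) {z : X₀ ⟶ A} {r : ℝ≥0∞}
    (hz : CellMap t M X₀ z r) {X Y : D} {f : X ⟶ Y} {g : Y ⟶ A} {h : A ⟶ X⟦(1 : ℤ)⟧}
    (hT : Triangle.mk f g h ∈ distTriang D) :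
    ∃ (W : D) (u : X ⟶ W), CellMap t M X u r ∧ Nonempty (Retract Y W) := by
  obtain ⟨Z₀, w, hw, hw₀⟩ := hz.exists_pullback hX₀ g
  obtain ⟨l, hl⟩ : ∃ l : Z₀ ⟶ X, w = l ≫ f := Triangle.coyoneda_exact₂ _ hT w hw₀
  obtain ⟨W, u, a, hu, hW⟩ := hw.exists_pushout l
  obtain ⟨ψ, hψ⟩ := hW f (𝟙 Y) (by simp [hl])
  exact ⟨W, u, hu, ⟨⟨a, ψ, hψ⟩⟩⟩

lemma CellMap.exists_shift {X Y : D} {z : X ⟶ Y} {r : ℝ≥0∞} (hz : CellMap t M X z r) (s : ℤ) :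
    ∃ z' : X⟦s⟧ ⟶ Y⟦s⟧,
      CellMap t M (X⟦s⟧) z' (r * ENNReal.ofReal (Real.exp (s * t))) := by
  induction hz with
  | id => exact ⟨𝟙 _, by simpa using CellMap.id⟩
  | @attach Y Z B z r hz f g h hT n e ih =>
    obtain ⟨z', hz'⟩ := ih
    have := hz'.attach (Triangle.shift_distinguished _ hT s) (n + s)
      ((shiftFunctor D s).mapIso e ≪≫ ((shiftFunctorAdd D n s).app M).symm)
    rw [ofReal_exp_add_mul, ← add_mul] at this
    exact ⟨_, this⟩

lemma Built.comp_cellMap {X Y : D} {z : X ⟶ Y} {r r' : ℝ≥0∞} (hX : Built t M X r)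
    (hz : CellMap t M X z r') : Built t M Y (r + r') := by
  induction hz with
  | id => simpa using hX
  | attach _ hT n e ih => simpa only [add_assoc] using ih.attach hT n e

/-- Towers compose: this does not require the octahedral axiom, because retracts are allowed. -/
lemma Built.trans {N P : D} {c : ℝ≥0∞} (hP : Built t N P c) {X A : D} (hX : IsZero X)
    {z : X ⟶ A} {r : ℝ≥0∞} (hz : CellMap t M X z r) (ρ : Retract N A) :
    Built t M P (r * c) := by
  induction hP with
  | zero hX => simpa using Built.zero hX
  | retract _ σ ih => exact ih.retract σ
  | @attach Y Z B c hY f g h hT n e ih =>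
    obtain ⟨z', hz'⟩ := hz.exists_shift n
    let σ : Retract B (A⟦n⟧) := (Retract.ofIso e).trans (ρ.map (shiftFunctor D n))
    obtain ⟨E, f', g', hT'⟩ := distinguished_cocone_triangle₂ (σ.r ≫ h)
    obtain ⟨τ⟩ := nonempty_retract_middle hT hT' (Retract.refl Y) σ (by simp) (by simp)
    obtain ⟨W, u, hu, ⟨π⟩⟩ :=
      hz'.exists_retract_of_distTriang ((shiftFunctor D n).map_isZero hX) hT'
    rw [mul_add]
    exact ((ih.comp_cellMap hu).retract π).retract τ

lemma Built.map (F : D ⥤ D) [F.CommShift ℤ] [F.IsTriangulated] {N : D} {c : ℝ≥0∞}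
    (hN : Built t M N c) : Built t (F.obj M) (F.obj N) c := by
  induction hN with
  | zero hX => exact .zero (F.map_isZero hX)
  | retract _ σ ih => exact ih.retract (σ.map F)
  | attach _ hT n e ih =>
    exact ih.attach (F.map_distinguished _ hT) n (F.mapIso e ≪≫ (F.commShiftIso n).app M)

lemma Built.map_fpow (F : D ⥤ D) [F.CommShift ℤ] [F.IsTriangulated] {N : D} {c : ℝ≥0∞}
    (hN : Built t M N c) (n : ℕ) : Built t ((fpow F n).obj M) ((fpow F n).obj N) c := by
  induction n with
  | zero => exact hN
  | succ n ih => exact ih.map F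

variable (M) in
/-- Some morphism `Y ⟶ Z` has cone `M⟦n⟧`. -/
def HasCell (n : ℤ) (Y Z : D) : Prop :=
  ∃ (f : Y ⟶ Z) (g : Z ⟶ M⟦n⟧) (h : M⟦n⟧ ⟶ Y⟦(1 : ℤ)⟧), Triangle.mk f g h ∈ distTriang D

lemma exists_cellMap_of_sequence (m : ℕ) (A : Fin (m + 1) → D) (k : Fin m → ℤ)
    (H : ∀ i : Fin m, HasCell M (k i) (A i.castSucc) (A i.succ)) :
    ∃ z : A 0 ⟶ A (Fin.last m),
      CellMap t M (A 0) z (∑ i, ENNReal.ofReal (Real.exp (k i * t))) := by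
  induction m with
  | zero => exact ⟨𝟙 _, by simpa using CellMap.id⟩
  | succ m ih =>
    obtain ⟨z, hz⟩ := ih (A ∘ Fin.castSucc) (k ∘ Fin.castSucc) (fun i => H i.castSucc)
    obtain ⟨f, g, h, hT⟩ := H (Fin.last m)
    rw [Fin.sum_univ_castSucc]
    exact ⟨_, hz.attach hT _ (Iso.refl _)⟩

end Cells

section Tower

variable {t : ℝ} {M : D}

lemma exists_biprod_iso_of_retract {Z E : D} (ρ : Retract Z E) :
    ∃ N' : D, Nonempty (E ≅ Z ⊞ N') := by
  obtain ⟨C, g, h, hT⟩ := distinguished_cocone_triangle ρ.i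
  have : Mono ρ.i := ⟨fun a b hab => by simpa using hab =≫ ρ.r⟩
  obtain ⟨e, -⟩ := exists_iso_binaryBiproduct_of_distTriang _ hT
    ((Triangle.mor₃_eq_zero_iff_mono₁ _ hT).2 this)
  exact ⟨C, ⟨e⟩⟩

/-- The retraction of the last object of a tower onto the object it computes. -/
noncomputable def Tower.retract {N : D} (T : Tower M N) : Retract N (T.A (Fin.last T.m)) where
  i := biprod.inl ≫ T.lastIso.inv
  r := T.lastIso.hom ≫ biprod.fst

lemma Tower.exists_cellMap {N : D} (T : Tower M N) :
    ∃ z : T.A 0 ⟶ T.A (Fin.last T.m), CellMap t M (T.A 0) z (T.value t) :=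
  exists_cellMap_of_sequence T.m T.A T.shifts fun i => ⟨T.f i, T.dist i⟩

lemma Tower.built {N : D} (T : Tower M N) : Built t M N (T.value t) := by
  obtain ⟨z, hz⟩ := T.exists_cellMap (t := t)
  simpa using ((Built.zero T.isZero_zero).comp_cellMap hz).retract T.retract

lemma Built.exists_tower {N : D} {r : ℝ≥0∞} (hN : Built t M N r) :
    ∃ T : Tower M N, T.value t = r := by
  induction hN with
  | @zero X hX =>
    exact ⟨{  m := 0
              A := fun _ => X
              f := fun i => i.elim0
              shifts := fun i => i.elim0
              N' := X
              isZero_zero := hX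
              lastIso := hX.iso ((biprod_isZero_iff X X).2 ⟨hX, hX⟩)
              dist := fun i => i.elim0 }, by simp [Tower.value]⟩
  | retract _ σ ih =>
    obtain ⟨T, hT⟩ := ih
    obtain ⟨N', ⟨e⟩⟩ := exists_biprod_iso_of_retract (σ.trans T.retract)
    exact ⟨{ T with N' := N', lastIso := e }, hT⟩
  | @attach Y Z B r hY f g h hT n e ih =>
    obtain ⟨T, rfl⟩ := ih
    let ρ := T.retract
    let σ : Retract B (M⟦n⟧) := Retract.ofIso e
    obtain ⟨E, f', g', hT'⟩ := distinguished_cocone_triangle₂ (σ.r ≫ h ≫ ρ.i⟦(1 : ℤ)⟧')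
    obtain ⟨τ⟩ := nonempty_retract_middle hT hT' ρ σ (by simp)
      (by simp [← Functor.map_comp])
    obtain ⟨N', ⟨ι⟩⟩ := exists_biprod_iso_of_retract τ
    let A' : Fin (T.m + 1 + 1) → D := Fin.snoc T.A E
    let k' : Fin (T.m + 1) → ℤ := Fin.snoc T.shifts n
    have H : ∀ i : Fin (T.m + 1), HasCell M (k' i) (A' i.castSucc) (A' i.succ) := by
      refine Fin.lastCases ?_ fun j => ?_
      · have : HasCell M n (T.A (Fin.last T.m)) E := ⟨f', g', _, hT'⟩
        simpa [A', k']
      · have : HasCell M (T.shifts j) (T.A j.castSucc) (T.A j.succ) := ⟨T.f j, T.dist j⟩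
        simpa only [A', k', Fin.succ_castSucc, Fin.snoc_castSucc]
    choose a ha using H
    refine ⟨{ m := T.m + 1
              A := A'
              f := a
              shifts := k'
              N' := N'
              isZero_zero := ?_
              lastIso := eqToIso (by simp [A']) ≪≫ ι
              dist := ha }, ?_⟩
    · have : A' 0 = T.A 0 := by
        simp only [A', ← Fin.castSucc_zero, Fin.snoc_castSucc]
      rw [this]
      exact T.isZero_zero
    · simp [Tower.value, Fin.sum_univ_castSucc, k']

end Tower

section Complexity

variable {t : ℝ}

lemma Tower.value_ne_top {M N : D} (T : Tower M N) : T.value t ≠ ⊤ := by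
  simp [Tower.value]

lemma Built.complexity_le {M N : D} {r : ℝ≥0∞} (hN : Built t M N r) : complexity t M N ≤ r := by
  obtain ⟨T, rfl⟩ := hN.exists_tower
  exact iInf_le _ T

lemma Tower.built_trans {M N P : D} (T : Tower M N) {c : ℝ≥0∞} (hP : Built t N P c) :
    Built t M P (T.value t * c) := by
  obtain ⟨z, hz⟩ := T.exists_cellMap (t := t)
  exact hP.trans T.isZero_zero hz T.retract

/-- Replacing both generators changes the complexity of the iterates of `F` at most by a
constant factor. -/
lemma exists_complexity_fpow_le (F : D ⥤ D) [F.CommShift ℤ] [F.IsTriangulated] (t : ℝ)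
    {G G' H H' : D} (hG : IsSplitGenerator G) (hH' : IsSplitGenerator H') :
    ∃ C : ℝ≥0∞, C ≠ ⊤ ∧
      ∀ n, complexity t G ((fpow F n).obj G') ≤ C * complexity t H ((fpow F n).obj H') := by
  obtain ⟨S⟩ := hG H
  obtain ⟨T⟩ := hH' G'
  have hS := S.value_ne_top (t := t)
  have hT := T.value_ne_top (t := t)
  have hC : S.value t * T.value t + 1 ≠ ⊤ := by finiteness
  refine ⟨S.value t * T.value t + 1, hC, fun n => ?_⟩
  rw [complexity, complexity, ENNReal.mul_iInf_of_ne (by simp) hC]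
  refine le_iInf fun R => ?_
  calc complexity t G ((fpow F n).obj G')
      ≤ S.value t * (R.value t * T.value t) :=
        (S.built_trans (R.built_trans (T.built.map_fpow F n))).complexity_le
    _ = S.value t * T.value t * R.value t := by ring
    _ ≤ (S.value t * T.value t + 1) * R.value t := by gcongr; exact le_self_add

end Complexity

lemma limsup_log_sub_mul_le {a b : ℕ → ℝ≥0∞} {C : ℝ≥0∞} (hC : C ≠ ⊤) (hab : ∀ n, b n ≤ C * a n)
    (u : ℕ → EReal) {w : ℕ → ℝ} (hw : ∀ n, 0 ≤ w n) (hw₀ : Tendsto w atTop (𝓝 0)) :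
    limsup (fun n => (ENNReal.log (b n) - u n) * (w n : EReal)) atTop ≤
      limsup (fun n => (ENNReal.log (a n) - u n) * (w n : EReal)) atTop := by
  obtain ⟨c, hc⟩ : ∃ c : ℝ, ENNReal.log C ≤ c :=
    ⟨_, EReal.le_coe_toReal (by simpa using hC)⟩
  have hlim : limsup (fun n => ((c * w n : ℝ) : EReal)) atTop = 0 := by
    refine Tendsto.limsup_eq ?_
    have := hw₀.const_mul c
    rw [mul_zero] at this
    exact_mod_cast (continuous_coe_real_ereal.tendsto 0).comp this
  have hle : ∀ n, (ENNReal.log (b n) - u n) * (w n : EReal) ≤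
      ((c * w n : ℝ) : EReal) + (ENNReal.log (a n) - u n) * (w n : EReal) := fun n => by
    have hw' : (0 : EReal) ≤ w n := by exact_mod_cast hw n
    have hb : ENNReal.log (b n) - u n ≤ c + (ENNReal.log (a n) - u n) := by
      rw [sub_eq_add_neg, sub_eq_add_neg, ← add_assoc]
      gcongr
      calc ENNReal.log (b n) ≤ ENNReal.log (C * a n) := ENNReal.log_monotone (hab n)
        _ = ENNReal.log C + ENNReal.log (a n) := ENNReal.log_mul_add
        _ ≤ c + ENNReal.log (a n) := by gcongr
    calc (ENNReal.log (b n) - u n) * (w n : EReal)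
        ≤ (c + (ENNReal.log (a n) - u n)) * (w n : EReal) := mul_le_mul_of_nonneg_right hb hw'
      _ = _ := by
        rw [mul_comm, EReal.left_distrib_of_nonneg_of_ne_top hw' (EReal.coe_ne_top _),
          mul_comm _ (c : EReal), mul_comm (w n : EReal) (_ - _), EReal.coe_mul]
  calc limsup (fun n => (ENNReal.log (b n) - u n) * (w n : EReal)) atTop
      ≤ limsup ((fun n => ((c * w n : ℝ) : EReal)) +
          fun n => (ENNReal.log (a n) - u n) * (w n : EReal)) atTop :=
        limsup_le_limsup (Eventually.of_forall hle)
    _ ≤ limsup (fun n => ((c * w n : ℝ) : EReal)) atTop +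
          limsup (fun n => (ENNReal.log (a n) - u n) * (w n : EReal)) atTop :=
        EReal.limsup_add_le (by rw [hlim]; simp) (by rw [hlim]; simp)
    _ = _ := by rw [hlim, zero_add]

/-- Limits superior of normalized logarithmic complexities do not depend on the generators. -/
lemma limsup_log_complexity_eq (F : D ⥤ D) [F.CommShift ℤ] [F.IsTriangulated] (t : ℝ)
    {G G' H H' : D} (hG : IsSplitGenerator G) (hG' : IsSplitGenerator G')
    (hH : IsSplitGenerator H) (hH' : IsSplitGenerator H')
    (u : ℕ → EReal) {w : ℕ → ℝ} (hw : ∀ n, 0 ≤ w n) (hw₀ : Tendsto w atTop (𝓝 0)) :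
    limsup (fun n => (ENNReal.log (complexity t G ((fpow F n).obj G')) - u n) * (w n : EReal))
        atTop =
      limsup (fun n => (ENNReal.log (complexity t H ((fpow F n).obj H')) - u n) * (w n : EReal))
        atTop := by
  obtain ⟨C, hC, hGH⟩ := exists_complexity_fpow_le F t (G' := G') (H := H) hG hH'
  obtain ⟨C', hC', hHG⟩ := exists_complexity_fpow_le F t (G' := H') (H := G) hH hG'
  exact le_antisymm (limsup_log_sub_mul_le hC hGH u hw hw₀)
    (limsup_log_sub_mul_le hC' hHG u hw hw₀)

lemma entropy_eq_of_isSplitGenerator (F : D ⥤ D) [F.CommShift ℤ] [F.IsTriangulated] (t : ℝ)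
    {G H : D} (hG : IsSplitGenerator G) (hH : IsSplitGenerator H) :
    entropy t F G = entropy t F H := by
  simpa only [entropy, sub_zero] using
    limsup_log_complexity_eq F t hG hG hH hH (fun _ => 0) (w := fun n => (n : ℝ)⁻¹)
      (fun n => by positivity) tendsto_inv_atTop_nhds_zero_nat

/-- The categorical polynomial entropy is computed, and is independent of
the choice of split generators: for any split generators `G₀` (used in the definition),
`G`, `G'`, and any `t` with `h_t(F) ≠ -∞`,
`h^pol_t(F) = limsup (log δ_t(G, Fⁿ G') - n h_t(F)) / log n`. -/
theorem statement_2 {D : Type u} [Category.{v} D] [HasZeroObject D] [Preadditive D]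
    [HasShift D ℤ] [∀ n : ℤ, (CategoryTheory.shiftFunctor D n).Additive] [Pretriangulated D]
    [HasBinaryBiproducts D]
    (F : D ⥤ D) [F.CommShift ℤ] [F.IsTriangulated] (hF : NotVirtuallyZero F)
    (G₀ G G' : D) (hG₀ : IsSplitGenerator G₀) (hG : IsSplitGenerator G)
    (hG' : IsSplitGenerator G') (t : ℝ) (ht : entropy t F G₀ ≠ ⊥) :
    polyEntropy t F G₀ =
      limsup (fun n : ℕ =>
        (ENNReal.log (complexity t G ((fpow F n).obj G')) - ((n : ℝ) : EReal) * entropy t F G₀)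
          * ((((Real.log n)⁻¹ : ℝ)) : EReal)) atTop
    ∧ polyEntropy t F G₀ = polyEntropy t F G := by
  have hw : ∀ n : ℕ, 0 ≤ (Real.log n)⁻¹ := fun n => inv_nonneg.2 (Real.log_natCast_nonneg n)
  have hw₀ : Tendsto (fun n : ℕ => (Real.log n)⁻¹) atTop (𝓝 0) :=
    (Real.tendsto_log_atTop.comp tendsto_natCast_atTop_atTop).inv_tendsto_atTop
  refine ⟨limsup_log_complexity_eq F t hG₀ hG₀ hG hG' _ hw hw₀, ?_⟩
  rw [polyEntropy, polyEntropy, entropy_eq_of_isSplitGenerator F t hG₀ hG]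
  exact limsup_log_complexity_eq F t hG₀ hG₀ hG hG _ hw hw₀

end CatDyn
end

section
/- Let D be a triangulated category with a split generator, F an endofunctor of D, and m ≥ 1 an integer. Then for every t ∈ ℝ with h_t(F) ≠ −∞: h^pol_t(F^m) ≤ h^pol_t(F), and the lower polynomial entropy (defined with liminf in place of limsup) satisfies the reverse inequality, i.e. the liminf version for F^m is ≥ the liminf version for F. In particular, if the limsup in the definition of h^pol_t(F) is an actual limit, then h^pol_t(F^m) = h^pol_t(F) and the liminf version for F^m also equals h^pol_t(F). -/
open CategoryTheory Category Limits Pretriangulated Filter Topology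
open scoped ENNReal

universe v u

namespace CatDyn

variable {D : Type u} [Category.{v} D] [Limits.HasZeroObject D] [Preadditive D]
  [HasShift D ℤ] [∀ n : ℤ, (CategoryTheory.shiftFunctor D n).Additive] [Pretriangulated D]
  [HasBinaryBiproducts D]

set_option linter.unusedSectionVars false

/-- `Y` is an extension of `K` by `X`: there is a distinguished triangle `X ⟶ Y ⟶ K ⟶ X⟦1⟧`. -/
def IsExt (X K Y : D) : Prop :=
  ∃ (f : X ⟶ Y) (g : Y ⟶ K) (h : K ⟶ X⟦(1 : ℤ)⟧), Triangle.mk f g h ∈ distTriang D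

namespace IsExt

lemma of_dist {T : Triangle D} (hT : T ∈ distTriang D) : IsExt T.obj₁ T.obj₃ T.obj₂ :=
  ⟨T.mor₁, T.mor₂, T.mor₃, hT⟩

lemma of_iso {X K Y X' K' Y' : D} (h : IsExt X K Y) (eX : X ≅ X') (eK : K ≅ K') (eY : Y ≅ Y') :
    IsExt X' K' Y' := by
  obtain ⟨f, g, h, hT⟩ := h
  refine ⟨eX.inv ≫ f ≫ eY.hom, eY.inv ≫ g ≫ eK.hom, eK.inv ≫ h ≫ eX.hom⟦(1 : ℤ)⟧', ?_⟩
  refine isomorphic_distinguished _ hT _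
    (Triangle.isoMk _ _ eX.symm eY.symm eK.symm ?_ ?_ ?_)
  · change (eX.inv ≫ f ≫ eY.hom) ≫ eY.inv = eX.inv ≫ f
    simp only [assoc, Iso.hom_inv_id, comp_id]
  · change (eY.inv ≫ g ≫ eK.hom) ≫ eK.inv = eY.inv ≫ g
    simp only [assoc, Iso.hom_inv_id, comp_id]
  · change (eK.inv ≫ h ≫ eX.hom⟦(1 : ℤ)⟧') ≫ eX.inv⟦(1 : ℤ)⟧' = eK.inv ≫ h
    simp only [assoc, ← Functor.map_comp, Iso.hom_inv_id, CategoryTheory.Functor.map_id, comp_id]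

lemma shift {X K Y : D} (h : IsExt X K Y) (n : ℤ) : IsExt (X⟦n⟧) (K⟦n⟧) (Y⟦n⟧) := by
  obtain ⟨f, g, h, hT⟩ := h
  exact of_dist (Triangle.shift_distinguished _ hT n)

lemma map {X K Y : D} (h : IsExt X K Y) (F : D ⥤ D) [F.CommShift ℤ] [F.IsTriangulated] :
    IsExt (F.obj X) (F.obj K) (F.obj Y) := by
  obtain ⟨f, g, h, hT⟩ := h
  exact of_dist (F.map_distinguished _ hT)

lemma nonempty_pi_bool_iso (g : Bool → D) [HasProduct g] :
    Nonempty (∏ᶜ g ≅ g true ⊞ g false) :=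
  ⟨{ hom := biprod.lift (Pi.π g true) (Pi.π g false)
     inv := Pi.lift (fun b => match b with
       | true => biprod.fst
       | false => biprod.snd)
     hom_inv_id := by
       apply Pi.hom_ext
       rintro (_ | _) <;> simp
     inv_hom_id := by ext <;> simp }⟩

lemma biprod {X K Y X' K' Y' : D} (h : IsExt X K Y) (h' : IsExt X' K' Y') :
    IsExt (X ⊞ X') (K ⊞ K') (Y ⊞ Y') := by
  obtain ⟨f, g, h, hT⟩ := h
  obtain ⟨f', g', h', hT'⟩ := h'
  let T : Bool → Triangle D := fun b => match b with
    | true => Triangle.mk f g h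
    | false => Triangle.mk f' g' h'
  have hp := productTriangle_distinguished T (by rintro (_ | _) <;> assumption)
  obtain ⟨e₁⟩ := nonempty_pi_bool_iso (fun j => (T j).obj₁)
  obtain ⟨e₂⟩ := nonempty_pi_bool_iso (fun j => (T j).obj₂)
  obtain ⟨e₃⟩ := nonempty_pi_bool_iso (fun j => (T j).obj₃)
  exact (of_dist hp).of_iso e₁ e₃ e₂

lemma of_isZero_right (X : D) {Z : D} (hZ : IsZero Z) : IsExt X Z X :=
  (of_dist (contractible_distinguished X)).of_iso (Iso.refl X)
    ((isZero_zero D).iso hZ) (Iso.refl X)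

lemma of_isZero_left (X : D) {Z : D} (hZ : IsZero Z) : IsExt Z X X :=
  (of_dist (contractible_distinguished₁ X)).of_iso
    ((isZero_zero D).iso hZ) (Iso.refl X) (Iso.refl X)

lemma biprod_right {X K Y : D} (h : IsExt X K Y) (W : D) : IsExt (X ⊞ W) K (Y ⊞ W) :=
  (h.biprod (of_isZero_right W (isZero_zero D))).of_iso (Iso.refl _)
    (isoBiprodZero (isZero_zero D)).symm (Iso.refl _)

lemma biprod_cone {X K Y : D} (h : IsExt X K Y) (W : D) : IsExt X (K ⊞ W) (Y ⊞ W) :=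
  (h.biprod (of_isZero_left W (isZero_zero D))).of_iso
    (isoBiprodZero (isZero_zero D)).symm (Iso.refl _) (Iso.refl _)

lemma nonempty_iso {X K Y : D} (h : IsExt X K Y) (hK : IsZero K) : Nonempty (X ≅ Y) := by
  obtain ⟨f, g, h, hT⟩ := h
  have : IsIso f := (Triangle.isZero₃_iff_isIso₁ _ hT).1 hK
  exact ⟨asIso f⟩

lemma exists_splitting_of_mono {X Y : D} (f : X ⟶ Y) [Mono f] :
    ∃ V : D, Nonempty (X ⊞ V ≅ Y) := by
  obtain ⟨V, g, h, hT⟩ := distinguished_cocone_triangle f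
  obtain ⟨e, -, -⟩ := exists_iso_binaryBiproduct_of_distTriang _ hT
    (Triangle.mor₃_eq_zero_of_mono₁ _ hT ‹_›)
  exact ⟨V, ⟨e.symm⟩⟩

/-- Associativity of extensions up to direct summands. If `X` is an extension of `E` by `C` and
`E` is an extension of `B` by `A`, then `X` is a direct summand of `X' ⊞ E` for an object `X'`
obtained from `C` by attaching `A` and then `B`. The octahedral property is not needed. -/
lemma exists_assoc {C E X A B : D} (hX : IsExt C E X) (hE : IsExt A B E) :
    ∃ Y X' V : D, IsExt C A Y ∧ IsExt Y B X' ∧ Nonempty (X ⊞ V ≅ X' ⊞ E) := by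
  obtain ⟨i, p, u, h₁⟩ := hX
  obtain ⟨a, b, w, h₂⟩ := hE
  obtain ⟨Y, j, q, h₃⟩ := distinguished_cocone_triangle₂ (a ≫ u)
  obtain ⟨s, hs₁, hs₂⟩ : ∃ s : B ⟶ Y⟦(1 : ℤ)⟧,
      b ≫ s = u ≫ (-j⟦(1 : ℤ)⟧') ∧ w ≫ (𝟙 A)⟦(1 : ℤ)⟧' = s ≫ (-q⟦(1 : ℤ)⟧') :=
    complete_distinguished_triangle_morphism _ _ h₂
      (rot_of_distTriang _ (rot_of_distTriang _ h₃)) (𝟙 A) u (id_comp _).symm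
  rw [Preadditive.comp_neg] at hs₁
  rw [CategoryTheory.Functor.map_id, comp_id, Preadditive.comp_neg] at hs₂
  obtain ⟨X', y, x, h₄⟩ := distinguished_cocone_triangle₂ s
  obtain ⟨l, hl⟩ : ∃ l : X ⟶ X', i ≫ l = j ≫ y := by
    obtain ⟨l, hl, -⟩ := complete_distinguished_triangle_morphism₂ _ _ h₁ h₄ j (-b)
      (show u ≫ j⟦(1 : ℤ)⟧' = (-b) ≫ s by rw [Preadditive.neg_comp, hs₁, neg_neg])
    exact ⟨l, hl⟩
  have : Mono (biprod.lift l p) := by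
    rw [Preadditive.mono_iff_cancel_zero]
    intro W f hf
    have hfl : f ≫ l = 0 := by simpa using hf =≫ biprod.fst
    have hfp : f ≫ p = 0 := by simpa using hf =≫ biprod.snd
    obtain ⟨c, rfl⟩ : ∃ c : W ⟶ C, f = c ≫ i := Triangle.coyoneda_exact₂ _ h₁ f hfp
    have hjy : (c ≫ j)⟦(1 : ℤ)⟧' ≫ y⟦(1 : ℤ)⟧' = 0 := by
      rw [← Functor.map_comp, assoc, ← hl, ← assoc, hfl, Functor.map_zero]
    obtain ⟨g, hg⟩ : ∃ g, (c ≫ j)⟦(1 : ℤ)⟧' = g ≫ s := Triangle.coyoneda_exact₁ _ h₄ _ hjy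
    have hjq : j ≫ q = 0 := comp_distTriang_mor_zero₁₂ _ h₃
    have hgw : g ≫ w = 0 := by
      rw [hs₂, Preadditive.comp_neg, ← assoc, ← hg, ← Functor.map_comp, assoc, hjq, comp_zero,
        Functor.map_zero, neg_zero]
    obtain ⟨e, rfl⟩ : ∃ e, g = e ≫ b := Triangle.coyoneda_exact₃ _ h₂ g hgw
    have hce : (c⟦(1 : ℤ)⟧' + e ≫ u) ≫ j⟦(1 : ℤ)⟧' = 0 := by
      rw [Preadditive.add_comp, ← Functor.map_comp, hg, assoc, hs₁]
      simp
    obtain ⟨k, hk⟩ : ∃ k, c⟦(1 : ℤ)⟧' + e ≫ u = k ≫ a ≫ u :=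
      Triangle.coyoneda_exact₁ _ h₃ _ hce
    have hui : u ≫ i⟦(1 : ℤ)⟧' = 0 := comp_distTriang_mor_zero₃₁ _ h₁
    apply (CategoryTheory.shiftFunctor D (1 : ℤ)).map_injective
    rw [Functor.map_comp, eq_sub_of_add_eq hk, Functor.map_zero]
    simp [hui]
  obtain ⟨V, hV⟩ := exists_splitting_of_mono (biprod.lift l p)
  exact ⟨Y, X', V, ⟨j, q, _, h₃⟩, ⟨y, x, s, h₄⟩, hV⟩

end IsExt

/-- `Reach M X Y l` means that `Y` is obtained from `X` by successively attaching the shifts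
`M⟦n⟧` for `n` in the list `l`, whose head is the cell attached last. -/
inductive Reach (M X : D) : D → List ℤ → Prop
  | of_iso {Y : D} (e : X ≅ Y) : Reach M X Y []
  | step {Y Z : D} {l : List ℤ} {n : ℤ} (h : Reach M X Y l) (h' : IsExt Y (M⟦n⟧) Z) :
      Reach M X Z (n :: l)

namespace Reach

open scoped ZeroObject

lemma trans_iso {M X Y Z : D} {l : List ℤ} (h : Reach M X Y l) (e : Y ≅ Z) : Reach M X Z l := by
  cases h with
  | of_iso e' => exact of_iso (e' ≪≫ e)
  | step h h' => exact step h (h'.of_iso (Iso.refl _) (Iso.refl _) e)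

lemma iso_trans {M X Y Z : D} {l : List ℤ} (e : X ≅ Y) (h : Reach M Y Z l) : Reach M X Z l := by
  induction h with
  | of_iso e' => exact of_iso (e ≪≫ e')
  | step h h' ih => exact step ih h'

lemma trans {M X Y Z : D} {l l' : List ℤ} (h : Reach M X Y l) (h' : Reach M Y Z l') :
    Reach M X Z (l' ++ l) := by
  induction h' with
  | of_iso e => exact h.trans_iso e
  | step _ h'' ih => exact step ih h''

lemma biprod_right {M X Y : D} {l : List ℤ} (h : Reach M X Y l) (W : D) :
    Reach M (X ⊞ W) (Y ⊞ W) l := by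
  induction h with
  | of_iso e => exact of_iso (biprod.mapIso e (Iso.refl W))
  | step _ h' ih => exact step ih (h'.biprod_right W)

lemma biprod_left {M X Y : D} {l : List ℤ} (h : Reach M X Y l) (W : D) :
    Reach M (W ⊞ X) (W ⊞ Y) l :=
  iso_trans (biprod.braiding _ _) ((h.biprod_right W).trans_iso (biprod.braiding _ _))

lemma shift {M X Y : D} {l : List ℤ} (h : Reach M X Y l) (k : ℤ) :
    Reach M (X⟦k⟧) (Y⟦k⟧) (l.map (· + k)) := by
  induction h with
  | of_iso e => exact of_iso ((CategoryTheory.shiftFunctor D k).mapIso e)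
  | @step Y Z l n _ h' ih =>
    exact step ih ((h'.shift k).of_iso (Iso.refl _)
      ((shiftFunctorAdd D n k).app M).symm (Iso.refl _))

lemma map {M X Y : D} {l : List ℤ} (h : Reach M X Y l)
    (F : D ⥤ D) [F.CommShift ℤ] [F.IsTriangulated] :
    Reach (F.obj M) (F.obj X) (F.obj Y) l := by
  induction h with
  | of_iso e => exact of_iso (F.mapIso e)
  | @step Y Z l n _ h' ih =>
    exact step ih ((h'.map F).of_iso (Iso.refl _) ((F.commShiftIso n).app M) (Iso.refl _))

/-- Attaching a shift of an object `E` built from finitely many cells amounts, up to a direct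
summand, to attaching a number of cells that depends on `E` only. -/
lemma exists_of_isExt {M O E : D} {l : List ℤ} (h : Reach M O E l) (hO : IsZero O) :
    ∃ l' : List ℤ, ∀ (k : ℤ) (C X : D), IsExt C (E⟦k⟧) X →
      ∃ V : D, Reach M C (X ⊞ V) (l'.map (· + k)) := by
  induction h with
  | of_iso e =>
    refine ⟨[], fun k C X hX => ⟨0, ?_⟩⟩
    obtain ⟨e'⟩ := hX.nonempty_iso
      ((CategoryTheory.shiftFunctor D k).map_isZero (hO.of_iso e.symm))
    exact of_iso (e' ≪≫ isoBiprodZero (isZero_zero D))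
  | @step E E' l n h h' ih =>
    obtain ⟨l', hl'⟩ := ih
    refine ⟨(n :: l) ++ (n :: l'), fun k C X hX => ?_⟩
    obtain ⟨Y, X', V, hY, hX', ⟨e⟩⟩ := hX.exists_assoc (h'.shift k)
    obtain ⟨V', hV'⟩ := hl' k C Y hY
    have h₁ : Reach M C (X' ⊞ V') ((n :: l').map (· + k)) :=
      step hV' ((hX'.biprod_right V').of_iso (Iso.refl _)
        ((shiftFunctorAdd D n k).app M).symm (Iso.refl _))
    have h₂ : Reach M (X' ⊞ V') ((X' ⊞ V') ⊞ E'⟦k⟧) ((n :: l).map (· + k)) :=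
      iso_trans (isoBiprodZero ((CategoryTheory.shiftFunctor D k).map_isZero hO))
        (((step h h').shift k).biprod_left (X' ⊞ V'))
    refine ⟨V ⊞ V', ?_⟩
    rw [List.map_append]
    refine (h₁.trans h₂).trans_iso ?_
    exact biprod.associator _ _ _ ≪≫ biprod.mapIso (Iso.refl _) (biprod.braiding _ _) ≪≫
      (biprod.associator _ _ _).symm ≪≫ biprod.mapIso e.symm (Iso.refl _) ≪≫
      biprod.associator _ _ _

/-- If `B` is a direct summand of an object built from cells `M⟦k⟧`, then, up to direct summands,
cells `B⟦n⟧` can be replaced by a fixed number of cells `M⟦k + n⟧`. -/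
lemma exists_substitution {M O B B' : D} {l : List ℤ} (h : Reach M O (B ⊞ B') l)
    (hO : IsZero O) :
    ∃ l' : List ℤ, ∀ (X Y : D) (p : List ℤ), Reach B X Y p →
      ∃ V : D, Reach M X (Y ⊞ V) (p.flatMap fun n => l'.map (· + n)) := by
  obtain ⟨l', hl'⟩ := h.exists_of_isExt hO
  refine ⟨l', fun X Y p hp => ?_⟩
  induction hp with
  | of_iso e => exact ⟨0, of_iso (e ≪≫ isoBiprodZero (isZero_zero D))⟩
  | @step Y Z p n _ h' ih =>
    obtain ⟨V, hV⟩ := ih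
    have : PreservesBinaryBiproducts (CategoryTheory.shiftFunctor D n) :=
      preservesBinaryBiproducts_of_preservesBiproducts _
    have hc : IsExt (Y ⊞ V) ((B ⊞ B')⟦n⟧) ((Z ⊞ V) ⊞ B'⟦n⟧) :=
      ((h'.biprod_right V).biprod_cone (B'⟦n⟧)).of_iso (Iso.refl _)
        ((CategoryTheory.shiftFunctor D n).mapBiprod B B').symm (Iso.refl _)
    obtain ⟨V', hV'⟩ := hl' n _ _ hc
    refine ⟨V ⊞ (B'⟦n⟧ ⊞ V'), ?_⟩
    rw [List.flatMap_cons]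
    exact (hV.trans hV').trans_iso (biprod.associator _ _ _ ≪≫ biprod.associator _ _ _)

end Reach

/-- The total weight `Σ e^{n t}` of a list of shifts. -/
noncomputable def weight (t : ℝ) (l : List ℤ) : ℝ≥0∞ :=
  (l.map fun n : ℤ => ENNReal.ofReal (Real.exp (n * t))).sum

lemma weight_ne_top (t : ℝ) (l : List ℤ) : weight t l ≠ ∞ := by
  induction l with
  | nil => simp [weight]
  | cons n l ih => simpa [weight] using ih

lemma weight_flatMap (t : ℝ) (l p : List ℤ) :
    weight t (p.flatMap fun n => l.map (· + n)) = weight t l * weight t p := by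
  have hshift (n : ℤ) : weight t (l.map (· + n)) =
      weight t l * ENNReal.ofReal (Real.exp (n * t)) := by
    simp only [weight, List.map_map, ← List.sum_map_mul_right]
    congr 2
    funext k
    simp [add_mul, Real.exp_add, ENNReal.ofReal_mul (Real.exp_nonneg _)]
  induction p with
  | nil => simp [weight]
  | cons n p ih =>
    rw [List.flatMap_cons]
    have : ∀ a b : List ℤ, weight t (a ++ b) = weight t a + weight t b := fun a b => by
      simp [weight]
    rw [this, ih, hshift, ← mul_add]
    simp [weight]

namespace Tower

lemma reach_aux {M N : D} (T : Tower M N) (t : ℝ) (k : ℕ) (hk : k ≤ T.m) :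
    ∃ l : List ℤ, Reach M (T.A 0) (T.A ⟨k, by lia⟩) l ∧
      weight t l = ∑ i : Fin k, ENNReal.ofReal (Real.exp (T.shifts (i.castLE hk) * t)) := by
  induction k with
  | zero => exact ⟨[], .of_iso (Iso.refl _), by simp [weight]⟩
  | succ k ih =>
    obtain ⟨l, hl, hw⟩ := ih (by lia)
    obtain ⟨g, h, hd⟩ := T.dist ⟨k, hk⟩
    refine ⟨T.shifts ⟨k, hk⟩ :: l, .step hl ⟨_, g, h, hd⟩, ?_⟩
    rw [Fin.sum_univ_castSucc, add_comm]
    change _ + weight t l = _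
    rw [hw]
    rfl

lemma exists_reach {M N : D} (T : Tower M N) (t : ℝ) :
    ∃ l : List ℤ, Reach M (T.A 0) (N ⊞ T.N') l ∧ weight t l = T.value t := by
  obtain ⟨l, hl, hw⟩ := T.reach_aux t T.m le_rfl
  exact ⟨l, hl.trans_iso T.lastIso, hw⟩

end Tower

lemma Reach.exists_sequence {M O X : D} {l : List ℤ} (h : Reach M O X l) (t : ℝ) :
    ∃ (m : ℕ) (A : Fin (m + 1) → D) (s : Fin m → ℤ), Nonempty (O ≅ A 0) ∧
      Nonempty (A (Fin.last m) ≅ X) ∧ (∀ i : Fin m, IsExt (A i.castSucc) (M⟦s i⟧) (A i.succ)) ∧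
      ∑ i, ENNReal.ofReal (Real.exp (s i * t)) = weight t l := by
  induction h with
  | @of_iso Y e =>
    exact ⟨0, fun _ => O, Fin.elim0, ⟨Iso.refl _⟩, ⟨e⟩, fun i => i.elim0, by simp [weight]⟩
  | @step Y Z l n _ h' ih =>
    obtain ⟨m, A, s, h₀, ⟨e⟩, hA, hs⟩ := ih
    refine ⟨m + 1, Fin.snoc (α := fun _ => D) A Z, Fin.snoc (α := fun _ => ℤ) s n, ?_, ?_, ?_, ?_⟩
    · have : Fin.snoc (α := fun _ => D) A Z 0 = A 0 := Fin.snoc_castSucc (α := fun _ => D) Z A 0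
      rwa [this]
    · rw [Fin.snoc_last]
      exact ⟨Iso.refl _⟩
    · intro i
      induction i using Fin.lastCases with
      | last =>
        rw [Fin.snoc_castSucc, Fin.snoc_last, Fin.succ_last, Fin.snoc_last]
        exact h'.of_iso e.symm (Iso.refl _) (Iso.refl _)
      | cast i =>
        rw [Fin.snoc_castSucc, Fin.snoc_castSucc, Fin.succ_castSucc, Fin.snoc_castSucc]
        exact hA i
    · rw [Fin.sum_univ_castSucc]
      simp [hs, weight, add_comm]

lemma complexity_le_weight {M N O V : D} {l : List ℤ} (t : ℝ) (hO : IsZero O)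
    (h : Reach M O (N ⊞ V) l) : complexity t M N ≤ weight t l := by
  obtain ⟨m, A, s, ⟨e₀⟩, ⟨e⟩, hA, hs⟩ := h.exists_sequence t
  choose f g h' hd using hA
  exact (iInf_le _ (⟨m, A, f, s, V, hO.of_iso e₀.symm, e, fun i => ⟨g i, h' i, hd i⟩⟩ :
    Tower M N)).trans hs.le

/-- An exact functor `F` distorts complexity by a bounded factor. -/
lemma exists_complexity_map_le (F : D ⥤ D) [F.CommShift ℤ] [F.IsTriangulated] {G : D}
    (hG : IsSplitGenerator G) (t : ℝ) :
    ∃ K : ℝ≥0∞, K ≠ ∞ ∧ ∀ N : D, complexity t G (F.obj N) ≤ K * complexity t G N := by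
  obtain ⟨T⟩ := hG (F.obj G)
  obtain ⟨l, hl, -⟩ := T.exists_reach t
  obtain ⟨l', hl'⟩ := hl.exists_substitution T.isZero_zero
  refine ⟨weight t l', weight_ne_top t l', fun N => ?_⟩
  have : Nonempty (Tower G N) := hG N
  conv_rhs => rw [complexity, ENNReal.mul_iInf (fun h => absurd h (weight_ne_top t l'))]
  refine le_iInf fun S => ?_
  obtain ⟨p, hp, hw⟩ := S.exists_reach t
  obtain ⟨V, hV⟩ := hl' _ _ _ (hp.map F)
  rw [← hw, ← weight_flatMap]
  refine complexity_le_weight (V := F.obj S.N' ⊞ V) t (F.map_isZero S.isZero_zero)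
    (hV.trans_iso ?_)
  have : PreservesBinaryBiproducts F := preservesBinaryBiproducts_of_preservesBiproducts F
  exact biprod.mapIso (F.mapBiprod N S.N') (Iso.refl V) ≪≫ biprod.associator _ _ _

lemma fpow_add (F : D ⥤ D) (a b : ℕ) : fpow F (a + b) = fpow F a ⋙ fpow F b := by
  induction b with
  | zero => rfl
  | succ b ih =>
    change fpow F (a + b) ⋙ F = _
    rw [ih]
    rfl

lemma fpow_fpow (F : D ⥤ D) (m n : ℕ) : fpow (fpow F m) n = fpow F (m * n) := by
  induction n with
  | zero => rfl
  | succ n ih =>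
    rw [mul_add_one, fpow_add F, ← ih]
    rfl

lemma mul_coe_inv_le_iff {z : EReal} {r c : ℝ} (hr : 0 < r) :
    z * ((r⁻¹ : ℝ) : EReal) ≤ c ↔ z ≤ ((c * r : ℝ) : EReal) := by
  have hr' : 0 < r⁻¹ := inv_pos.2 hr
  induction z with
  | bot => simp [EReal.bot_mul_coe_of_pos hr']
  | top => simp [EReal.top_mul_coe_of_pos hr', -EReal.coe_mul]
  | coe x => rw [← EReal.coe_mul, EReal.coe_le_coe_iff, EReal.coe_le_coe_iff,
      ← div_eq_mul_inv, div_le_iff₀ hr]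

lemma le_add_mul_of_forall_succ_le {a : ℕ → EReal} {κ : ℝ} (ha : ∀ n, a (n + 1) ≤ a n + κ)
    (n j : ℕ) : a (n + j) ≤ a n + ((j * κ : ℝ) : EReal) := by
  induction j with
  | zero => simp
  | succ j ih =>
    refine (ha (n + j)).trans ((add_le_add_left ih _).trans ?_)
    rw [add_assoc, ← EReal.coe_add, Nat.cast_succ, add_one_mul]

lemma limsup_mul_inv_subseq {a : ℕ → EReal} {κ : ℝ} (hκ : 0 ≤ κ) (ha : ∀ n, a (n + 1) ≤ a n + κ)
    {m : ℕ} (hm : 0 < m) :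
    limsup (fun n : ℕ => a (m * n) * ((((m * n : ℕ) : ℝ)⁻¹ : ℝ) : EReal)) atTop =
      limsup (fun n : ℕ => a n * (((n : ℝ)⁻¹ : ℝ) : EReal)) atTop := by
  have hm' : (0 : ℝ) < m := by exact_mod_cast hm
  have hφ : Tendsto (fun n : ℕ => m * n) atTop atTop := tendsto_id.const_mul_atTop' hm
  apply le_antisymm
  · exact (limsup_comp (fun n : ℕ => a n * (((n : ℝ)⁻¹ : ℝ) : EReal)) (fun n => m * n)
      atTop).trans_le (limsup_le_limsup_of_le hφ)
  · refine le_of_forall_gt_imp_ge_of_dense fun c hc => ?_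
    obtain ⟨x, hx, hxc⟩ := EReal.lt_iff_exists_real_btwn.1 hc
    obtain ⟨y, hxy, hyc⟩ := EReal.lt_iff_exists_real_btwn.1 hxc
    rw [EReal.coe_lt_coe_iff] at hxy
    refine limsup_le_of_le (by isBoundedDefault) ?_
    have hdiv : Tendsto (fun k : ℕ => k / m) atTop atTop := Nat.tendsto_div_const_atTop hm.ne'
    filter_upwards [hdiv.eventually (eventually_lt_of_limsup_lt hx), eventually_ge_atTop m,
      eventually_ge_atTop ⌈m * (|x| + κ) / (y - x)⌉₊] with k hk hkm hkl
    have hkm' : 0 < k := hm.trans_le hkm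
    have hn : 0 < m * (k / m) := Nat.mul_pos hm (Nat.div_pos hkm hm)
    refine le_trans ?_ hyc.le
    rw [mul_coe_inv_le_iff (by exact_mod_cast hkm')]
    replace hk := (mul_coe_inv_le_iff (by exact_mod_cast hn)).1 hk.le
    have hkj := le_add_mul_of_forall_succ_le ha (m * (k / m)) (k % m)
    rw [Nat.div_add_mod] at hkj
    refine hkj.trans ((add_le_add_left hk _).trans ?_)
    rw [← EReal.coe_add, EReal.coe_le_coe_iff]
    have hsplit : ((m * (k / m) : ℕ) : ℝ) = k - (k % m : ℕ) := by
      rw [eq_sub_iff_add_eq]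
      exact_mod_cast Nat.div_add_mod k m
    have hj : ((k % m : ℕ) : ℝ) ≤ m := by exact_mod_cast (Nat.mod_lt k hm).le
    have hj₀ : (0 : ℝ) ≤ ((k % m : ℕ) : ℝ) := Nat.cast_nonneg _
    rw [hsplit]
    have hl := (div_le_iff₀ (sub_pos.2 hxy)).1 (Nat.ceil_le.1 hkl)
    have h₁ : ((k % m : ℕ) : ℝ) * (κ - x) ≤ m * (|x| + κ) :=
      (mul_le_mul_of_nonneg_left (by linarith [neg_abs_le x]) hj₀).trans
        (mul_le_mul_of_nonneg_right hj (by positivity))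
    linarith

lemma limsup_comp_mul_le {b : ℕ → EReal} {r : ℕ → ℝ} {φ : ℕ → ℕ} (hφ : Tendsto φ atTop atTop)
    (hr : Tendsto r atTop (𝓝 1)) :
    limsup (fun n => b (φ n) * (r n : EReal)) atTop ≤ limsup b atTop := by
  refine le_of_forall_gt_imp_ge_of_dense fun c hc => ?_
  obtain ⟨x, hx, hxc⟩ := EReal.lt_iff_exists_real_btwn.1 hc
  obtain ⟨y, hxy, hyc⟩ := EReal.lt_iff_exists_real_btwn.1 hxc
  rw [EReal.coe_lt_coe_iff] at hxy
  have hxr : Tendsto (fun n => x * r n) atTop (𝓝 x) := by simpa using hr.const_mul x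
  refine limsup_le_of_le (by isBoundedDefault) ?_
  filter_upwards [hφ.eventually (eventually_lt_of_limsup_lt hx), hr.eventually_const_lt one_pos,
    hxr.eventually_lt_const hxy] with n hn hrn hxn
  calc b (φ n) * (r n : EReal) ≤ x * (r n : EReal) :=
        mul_le_mul_of_nonneg_right hn.le (EReal.coe_nonneg.2 hrn.le)
    _ = ((x * r n : ℝ) : EReal) := (EReal.coe_mul _ _).symm
    _ ≤ y := EReal.coe_le_coe_iff.2 hxn.le
    _ ≤ c := hyc.le

lemma le_liminf_comp_mul {b : ℕ → EReal} {r : ℕ → ℝ} {φ : ℕ → ℕ} (hφ : Tendsto φ atTop atTop)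
    (hr : Tendsto r atTop (𝓝 1)) :
    liminf b atTop ≤ liminf (fun n => b (φ n) * (r n : EReal)) atTop := by
  have h := limsup_comp_mul_le (b := -b) hφ hr
  have he : (fun n => (-b) (φ n) * (r n : EReal)) = -fun n => b (φ n) * (r n : EReal) := by
    funext n
    simp
  rwa [he, EReal.limsup_neg, EReal.limsup_neg, EReal.neg_le_neg_iff] at h

lemma tendsto_log_mul_mul_inv_log {m : ℕ} (hm : 0 < m) :
    Tendsto (fun n : ℕ => Real.log (m * n : ℕ) * (Real.log n)⁻¹) atTop (𝓝 1) := by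
  have hlog : Tendsto (fun n : ℕ => Real.log n) atTop atTop :=
    Real.tendsto_log_atTop.comp tendsto_natCast_atTop_atTop
  have h : Tendsto (fun n : ℕ => Real.log m * (Real.log n)⁻¹ + 1) atTop (𝓝 1) := by
    simpa using (hlog.inv_tendsto_atTop.const_mul (Real.log m)).add_const 1
  refine h.congr' ?_
  filter_upwards [hlog.eventually_gt_atTop 0, eventually_gt_atTop 0] with n hn hn'
  have hm' : (m : ℝ) ≠ 0 := by exact_mod_cast hm.ne'
  have hn'' : (n : ℝ) ≠ 0 := by exact_mod_cast hn'.ne'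
  rw [Nat.cast_mul, Real.log_mul hm' hn'', add_mul, mul_inv_cancel₀ hn.ne']

lemma exists_log_complexity_succ_le (F : D ⥤ D) [F.CommShift ℤ] [F.IsTriangulated] {G : D}
    (hG : IsSplitGenerator G) (t : ℝ) :
    ∃ κ : ℝ, 0 ≤ κ ∧ ∀ n : ℕ, ENNReal.log (complexity t G ((fpow F (n + 1)).obj G)) ≤
      ENNReal.log (complexity t G ((fpow F n).obj G)) + κ := by
  obtain ⟨K, hK, h⟩ := exists_complexity_map_le F hG t
  have hK' : (0 : ℝ) < K.toReal + 1 := by positivity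
  refine ⟨Real.log (K.toReal + 1), Real.log_nonneg (by linarith [K.toReal_nonneg]), fun n => ?_⟩
  rw [← ENNReal.log_ofReal_of_pos hK', ← ENNReal.log_mul_add]
  refine ENNReal.log_monotone ((h _).trans ?_)
  rw [mul_comm]
  gcongr
  rw [← ENNReal.ofReal_toReal hK]
  exact ENNReal.ofReal_le_ofReal (by simp [hK])

lemma entropy_fpow (F : D ⥤ D) [F.CommShift ℤ] [F.IsTriangulated] {G : D}
    (hG : IsSplitGenerator G) {m : ℕ} (hm : 0 < m) (t : ℝ) :
    entropy t (fpow F m) G = ((m : ℝ) : EReal) * entropy t F G := by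
  obtain ⟨κ, hκ, h⟩ := exists_log_complexity_succ_le F hG t
  have hm' : (m : ℝ) ≠ 0 := by exact_mod_cast hm.ne'
  rw [entropy, entropy, ← limsup_mul_inv_subseq
    (a := fun n => ENNReal.log (complexity t G ((fpow F n).obj G))) hκ h hm,
    ← EReal.limsup_const_mul_of_nonneg_of_ne_top (by exact_mod_cast m.cast_nonneg)
      (EReal.coe_ne_top _)]
  congr 1
  funext n
  rw [fpow_fpow, mul_left_comm, ← EReal.coe_mul, Nat.cast_mul, mul_inv,
    mul_inv_cancel_left₀ hm']

lemma polyEntropy_term_fpow (F : D ⥤ D) [F.CommShift ℤ] [F.IsTriangulated] {G : D}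
    (hG : IsSplitGenerator G) {m : ℕ} (hm : 0 < m) (t : ℝ) :
    (fun n : ℕ => (ENNReal.log (complexity t G ((fpow (fpow F m) n).obj G)) -
      ((n : ℝ) : EReal) * entropy t (fpow F m) G) * ((((Real.log n)⁻¹ : ℝ)) : EReal)) =ᶠ[atTop]
    fun n : ℕ => (ENNReal.log (complexity t G ((fpow F (m * n)).obj G)) -
      (((m * n : ℕ) : ℝ) : EReal) * entropy t F G) * (((Real.log (m * n : ℕ))⁻¹ : ℝ) : EReal) *
        ((Real.log (m * n : ℕ) * (Real.log n)⁻¹ : ℝ) : EReal) := by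
  filter_upwards [eventually_ge_atTop 2] with n hn
  have hlog : Real.log (m * n : ℕ) ≠ 0 :=
    (Real.log_pos (by exact_mod_cast (show 1 < m * n by nlinarith))).ne'
  rw [mul_assoc, ← EReal.coe_mul, inv_mul_cancel_left₀ hlog, fpow_fpow, entropy_fpow F hG hm,
    ← mul_assoc, ← EReal.coe_mul, Nat.cast_mul, mul_comm (n : ℝ)]

/-- Powers: for `m ≥ 1`, `h^pol_t(Fᵐ) ≤ h^pol_t(F)` and the lower
polynomial entropy satisfies the reverse inequality; if the `limsup` defining
`h^pol_t(F)` is an actual limit (i.e. it equals the `liminf` version), then both the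
upper and lower polynomial entropies of `Fᵐ` equal `h^pol_t(F)`. -/
theorem statement_6 {D : Type u} [Category.{v} D] [HasZeroObject D] [Preadditive D]
    [HasShift D ℤ] [∀ n : ℤ, (CategoryTheory.shiftFunctor D n).Additive] [Pretriangulated D]
    [HasBinaryBiproducts D]
    (F : D ⥤ D) [F.CommShift ℤ] [F.IsTriangulated] (hF : NotVirtuallyZero F)
    (G : D) (hG : IsSplitGenerator G) (m : ℕ) (hm : 1 ≤ m)
    (t : ℝ) (ht : entropy t F G ≠ ⊥) :
    polyEntropy t (fpow F m) G ≤ polyEntropy t F G ∧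
    polyEntropyLow t F G ≤ polyEntropyLow t (fpow F m) G ∧
    (polyEntropyLow t F G = polyEntropy t F G →
      polyEntropy t (fpow F m) G = polyEntropy t F G ∧
      polyEntropyLow t (fpow F m) G = polyEntropy t F G) := by
  have hφ : Tendsto (fun n : ℕ => m * n) atTop atTop := tendsto_id.const_mul_atTop' hm
  have hr := tendsto_log_mul_mul_inv_log hm
  have hterm := polyEntropy_term_fpow F hG hm t
  have hup : polyEntropy t (fpow F m) G ≤ polyEntropy t F G := by
    rw [polyEntropy, limsup_congr hterm]
    exact limsup_comp_mul_le (b := fun n : ℕ =>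
      (ENNReal.log (complexity t G ((fpow F n).obj G)) - ((n : ℝ) : EReal) * entropy t F G)
        * ((((Real.log n)⁻¹ : ℝ)) : EReal)) hφ hr
  have hlow : polyEntropyLow t F G ≤ polyEntropyLow t (fpow F m) G := by
    rw [polyEntropyLow, polyEntropyLow, liminf_congr hterm]
    exact le_liminf_comp_mul (b := fun n : ℕ =>
      (ENNReal.log (complexity t G ((fpow F n).obj G)) - ((n : ℝ) : EReal) * entropy t F G)
        * ((((Real.log n)⁻¹ : ℝ)) : EReal)) hφ hr
  have hle : polyEntropyLow t (fpow F m) G ≤ polyEntropy t (fpow F m) G := liminf_le_limsup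
  exact ⟨hup, hlow, fun h => ⟨le_antisymm hup (h ▸ hlow.trans hle),
    le_antisymm (hle.trans hup) (h ▸ hlow)⟩⟩

end CatDyn
end

section
/- Let k be a field and let D be a k-linear, Hom-finite, Ext-bounded triangulated category. Let d ≥ 1 be an integer, P a triangulated endofunctor of D, and G, G′, C objects of D such that for every n ≥ 1 there is a distinguished triangle C[−2d(n−1)] → P^{n−1}(G) → Pⁿ(G) → C[−2d(n−1)+1] (as holds for the ℙ-twist P = P_E along a ℙ^d-object E, with C = Cone(Hom(E, G[*−2])⊗E → Hom(E, G[*])⊗E)). Set A_t = ε_t(G′, C) and B_t = ε_t(G′, G). Then for every n ≥ 1: ε_0(G′, Pⁿ(G)) ≤ n·A_0 + B_0; ε_t(G′, Pⁿ(G)) ≤ (e^{−2dnt}/(e^{−2dt} − 1))·A_t + B_t if t < 0; and ε_t(G′, Pⁿ(G)) ≤ (e^t/(1 − e^{−2dt}))·A_t + B_t if t > 0. -/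
open CategoryTheory Category Limits Pretriangulated Filter Topology
open scoped ENNReal

universe v u

namespace CatDyn

variable {D : Type u} [Category.{v} D] [Limits.HasZeroObject D] [Preadditive D]
  [HasShift D ℤ] [∀ n : ℤ, (CategoryTheory.shiftFunctor D n).Additive] [Pretriangulated D]
  [HasBinaryBiproducts D]

section Linear

variable (𝕜 : Type*) [Field 𝕜] [Linear 𝕜 D]

/-- Dimension of the middle term of the `Hom(X, -)` sequence of a distinguished triangle. -/
lemma finrank_hom_obj₂_le (hfin : HomFinite D 𝕜) (X : D) (T : Triangle D)
    (hT : T ∈ distTriang D) :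
    Module.finrank 𝕜 (X ⟶ T.obj₂) ≤
      Module.finrank 𝕜 (X ⟶ T.obj₁) + Module.finrank 𝕜 (X ⟶ T.obj₃) := by
  have := hfin X T.obj₁
  have := hfin X T.obj₂
  have := hfin X T.obj₃
  have hker : LinearMap.ker (Linear.rightComp 𝕜 X T.mor₂) ≤
      LinearMap.range (Linear.rightComp 𝕜 X T.mor₁) := by
    intro f hf
    obtain ⟨g, hg⟩ := Triangle.coyoneda_exact₂ T hT f hf
    exact ⟨g, hg.symm⟩
  have h₁ := (Submodule.finrank_mono hker).trans
    (LinearMap.finrank_range_le (Linear.rightComp 𝕜 X T.mor₁))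
  have h₂ := Submodule.finrank_le (LinearMap.range (Linear.rightComp 𝕜 X T.mor₂))
  have h₃ := LinearMap.finrank_range_add_finrank_ker (Linear.rightComp 𝕜 X T.mor₂)
  omega

/-- The Ext-distance is subadditive on distinguished triangles. -/
lemma extDist_obj₂_le (hfin : HomFinite D 𝕜) (t : ℝ) (X : D) (T : Triangle D)
    (hT : T ∈ distTriang D) :
    extDist 𝕜 t X T.obj₂ ≤ extDist 𝕜 t X T.obj₁ + extDist 𝕜 t X T.obj₃ := by
  unfold extDist
  rw [← ENNReal.tsum_add]
  refine ENNReal.tsum_le_tsum fun k => ?_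
  rw [← add_mul]
  gcongr
  exact_mod_cast finrank_hom_obj₂_le 𝕜 hfin X _ (T.shift_distinguished hT k)

lemma finrank_hom_congr (X : D) {Y Z : D} (e : Y ≅ Z) :
    Module.finrank 𝕜 (X ⟶ Y) = Module.finrank 𝕜 (X ⟶ Z) :=
  (LinearEquiv.ofLinearMap (Linear.rightComp 𝕜 X e.hom) (Linear.rightComp 𝕜 X e.inv)
    (by ext; simp) (by ext; simp)).finrank_eq

/-- Shifting the second variable by `m` scales the Ext-distance by `e^{mt}`. -/
lemma extDist_shift (t : ℝ) (X Y : D) (m : ℤ) :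
    extDist 𝕜 t X (Y⟦m⟧) = ENNReal.ofReal (Real.exp (m * t)) * extDist 𝕜 t X Y := by
  unfold extDist
  rw [← (Equiv.addLeft m).tsum_eq (fun k : ℤ =>
    (Module.finrank 𝕜 (X ⟶ Y⟦k⟧) : ℝ≥0∞) * ENNReal.ofReal (Real.exp (-k * t))),
    ← ENNReal.tsum_mul_left]
  refine tsum_congr fun k => ?_
  rw [Equiv.coe_addLeft, finrank_hom_congr 𝕜 X ((shiftFunctorAdd D m k).app Y), Functor.comp_obj,
    mul_left_comm, ← ENNReal.ofReal_mul (Real.exp_nonneg _), ← Real.exp_add]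
  congr 4
  push_cast
  ring

/-- Iterated subadditivity along the triangles `C[-2dn] → Pⁿ(G) → P^{n+1}(G) → C[-2dn][1]`. -/
lemma extDist_fpow_le (hfin : HomFinite D 𝕜) (d : ℕ) (P : D ⥤ D) (G G' C : D)
    (htri : ∀ n : ℕ, ∃ (f : (C⟦(-(2 * (d : ℤ))) * n⟧) ⟶ (fpow P n).obj G)
      (g : (fpow P n).obj G ⟶ (fpow P (n + 1)).obj G)
      (h : (fpow P (n + 1)).obj G ⟶ (C⟦(-(2 * (d : ℤ))) * n⟧)⟦(1 : ℤ)⟧),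
      Triangle.mk f g h ∈ distTriang D) (t : ℝ) (n : ℕ) :
    extDist 𝕜 t G' ((fpow P n).obj G) ≤
      ENNReal.ofReal (Real.exp t * ∑ i ∈ Finset.range n, Real.exp (-(2 * (d : ℝ)) * t) ^ i)
        * extDist 𝕜 t G' C + extDist 𝕜 t G' G := by
  induction n with
  | zero => simp [fpow]
  | succ n ih =>
    obtain ⟨f, g, h, hT⟩ := htri n
    have hstep := extDist_obj₂_le 𝕜 hfin t G' _ (rot_of_distTriang _ hT)
    simp only [Triangle.rotate_obj₁, Triangle.rotate_obj₂, Triangle.rotate_obj₃, Triangle.mk_obj₁,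
      Triangle.mk_obj₂, Triangle.mk_obj₃, extDist_shift] at hstep
    have hexp : ENNReal.ofReal (Real.exp ((1 : ℤ) * t)) *
        (ENNReal.ofReal (Real.exp (((-(2 * (d : ℤ)) * n : ℤ) : ℝ) * t)) * extDist 𝕜 t G' C) =
        ENNReal.ofReal (Real.exp t * Real.exp (-(2 * (d : ℝ)) * t) ^ n) * extDist 𝕜 t G' C := by
      rw [ENNReal.ofReal_mul (Real.exp_nonneg _), mul_assoc, ← Real.exp_nat_mul]
      congr 4
      · simp
      · push_cast
        ring
    rw [hexp] at hstep
    rw [Finset.sum_range_succ, mul_add, ENNReal.ofReal_add (by positivity) (by positivity), add_mul]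
    calc _ ≤ _ := hstep
      _ ≤ _ := add_le_add_left ih _
      _ = _ := by ring

end Linear

/-- Upper bound for iterates of (an abstraction of) a ℙ-twist:
if for every `n` there is a distinguished triangle
`C[-2dn] → Pⁿ(G) → P^{n+1}(G) → C[-2dn][1]`, then, with `A_t = ε_t(G', C)` and
`B_t = ε_t(G', G)`, one has for all `n ≥ 1` the stated bounds on `ε_t(G', Pⁿ(G))`
according to the sign of `t`. -/
theorem statement_14 {D : Type u} [Category.{v} D] [HasZeroObject D] [Preadditive D]
    [HasShift D ℤ] [∀ n : ℤ, (CategoryTheory.shiftFunctor D n).Additive] [Pretriangulated D]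
    [HasBinaryBiproducts D] (𝕜 : Type*) [Field 𝕜] [Linear 𝕜 D]
    (hfin : HomFinite D 𝕜) (hbdd : ExtBounded D)
    (d : ℕ) (hd : 1 ≤ d) (P : D ⥤ D) [P.CommShift ℤ] [P.IsTriangulated]
    (G G' C : D)
    (htri : ∀ n : ℕ, ∃ (f : (C⟦(-(2 * (d : ℤ))) * n⟧) ⟶ (fpow P n).obj G)
      (g : (fpow P n).obj G ⟶ (fpow P (n + 1)).obj G)
      (h : (fpow P (n + 1)).obj G ⟶ (C⟦(-(2 * (d : ℤ))) * n⟧)⟦(1 : ℤ)⟧),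
      Triangle.mk f g h ∈ distTriang D) :
    ∀ n : ℕ, 1 ≤ n →
      (extDist 𝕜 0 G' ((fpow P n).obj G) ≤
        (n : ℝ≥0∞) * extDist 𝕜 0 G' C + extDist 𝕜 0 G' G) ∧
      (∀ t : ℝ, t < 0 →
        extDist 𝕜 t G' ((fpow P n).obj G) ≤
          ENNReal.ofReal (Real.exp (-(2 * (d : ℝ)) * n * t) / (Real.exp (-(2 * (d : ℝ)) * t) - 1))
            * extDist 𝕜 t G' C + extDist 𝕜 t G' G) ∧
      (∀ t : ℝ, 0 < t →
        extDist 𝕜 t G' ((fpow P n).obj G) ≤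
          ENNReal.ofReal (Real.exp t / (1 - Real.exp (-(2 * (d : ℝ)) * t)))
            * extDist 𝕜 t G' C + extDist 𝕜 t G' G) := by
  intro n _
  have hd' : (0 : ℝ) < d := by exact_mod_cast hd
  have key := fun t => extDist_fpow_le 𝕜 hfin d P G G' C htri t n
  refine ⟨by simpa using key 0, fun t ht => (key t).trans ?_, fun t ht => (key t).trans ?_⟩
  · gcongr
    have hq : 1 < Real.exp (-(2 * (d : ℝ)) * t) := Real.one_lt_exp_iff.2 (by nlinarith)
    have hqn : Real.exp (-(2 * (d : ℝ)) * n * t) = Real.exp (-(2 * (d : ℝ)) * t) ^ n := by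
      rw [← Real.exp_nat_mul]
      congr 1
      ring
    rw [geom_sum_eq hq.ne', hqn, ← mul_div_assoc]
    have hone : (1 : ℝ) ≤ Real.exp (-(2 * (d : ℝ)) * t) ^ n := one_le_pow₀ hq.le
    have het : Real.exp t ≤ 1 := Real.exp_le_one_iff.2 ht.le
    refine div_le_div_of_nonneg_right ?_ (sub_nonneg.2 hq.le)
    nlinarith
  · gcongr
    have hq : Real.exp (-(2 * (d : ℝ)) * t) < 1 := Real.exp_lt_one_iff.2 (by nlinarith)
    rw [geom_sum_eq hq.ne, ← neg_div_neg_eq, neg_sub, neg_sub, ← mul_div_assoc]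
    refine div_le_div_of_nonneg_right ?_ (sub_nonneg.2 hq.le)
    exact mul_le_of_le_one_right (Real.exp_nonneg _) (sub_le_self _ (by positivity))

end CatDyn
end
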